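/- arXiv:2004.07824 — 2 statements merged into one kernel-verified Lean document; each statement's English description precedes it below -/
import Mathlib

section
/- Λ_Z̃ Δ = Δ Λ_Ỹ on 𝒫_{Ỹ,Z̃}: for every f ∈ 𝒫_{Ỹ,Z̃}, Λ_Z̃(Δ f) = Δ(Λ_Ỹ f). -/
open MvPolynomial

noncomputable section

/-- The base field `K = ℚ(b)`: rational functions in an indeterminate `b` over `ℚ`. -/
abbrev K : Type := RatFunc ℚ

/-- The indeterminate `b ∈ K`. -/
def bb : K := RatFunc.X

/-- `α = 1 + b`. -/
def alpha : K := 1 + bb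

/-- Variables: `p i` (used for `i ≥ 1`) and `y i`, `y' i`, `z i`, `z' i` (`i ≥ 0`). -/
inductive Var : Type
  | p : ℕ → Var
  | y : ℕ → Var
  | y' : ℕ → Var
  | z : ℕ → Var
  | z' : ℕ → Var
  deriving DecidableEq

/-- The ambient polynomial ring `R′`. -/
abbrev R : Type := MvPolynomial Var K

/-- The generic operator
`Λ_A = α Σ_{i,j≥1} i a_{i+j−1} ∂²/∂p_i∂a_{j−1} + Σ_{i,j≥1} a_{i−1} p_j ∂/∂a_{i+j−1}
     + b Σ_{i≥1} i a_i ∂/∂a_i` for the alphabet `a ∈ {y, y′, z, z′}`. -/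
def Lam (a : ℕ → Var) (f : R) : R :=
  alpha • (∑ᶠ (i : ℕ) (j : ℕ), ((i + 1 : ℕ) : K) •
      (X (a (i + j + 1)) * pderiv (Var.p (i + 1)) (pderiv (a j) f)))
    + (∑ᶠ (i : ℕ) (j : ℕ), X (a i) * X (Var.p (j + 1)) * pderiv (a (i + j + 1)) f)
    + bb • (∑ᶠ (i : ℕ), ((i + 1 : ℕ) : K) • (X (a (i + 1)) * pderiv (a (i + 1)) f))

/-- The generic shift operator `A_+ = Σ_{i≥0} a_{i+1} ∂/∂a_i`. -/
def Plus (a : ℕ → Var) (f : R) : R := ∑ᶠ (i : ℕ), X (a (i + 1)) * pderiv (a i) f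

/-- The generic operator `Θ_A = Σ_{i≥1} p_i ∂/∂a_i`. -/
def Theta (a : ℕ → Var) (f : R) : R := ∑ᶠ (i : ℕ), X (Var.p (i + 1)) * pderiv (a (i + 1)) f

/-- `M_Z = α Σ_{i,j,k≥1} y′_{i+j−1} z′_{k−1} ∂²/∂y_{i+k−1}∂z_{j−1}
         + Σ_{i,j,k≥1} y_{i+j−1} z_{k−1} ∂²/∂y′_{i+k−1}∂z′_{j−1}
         + b Σ_{i,j,k≥1} y′_{i+j−1} z′_{k−1} ∂²/∂y′_{i+k−1}∂z′_{j−1}`. -/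
def MZ (f : R) : R :=
  alpha • (∑ᶠ (i : ℕ) (j : ℕ) (k : ℕ), X (Var.y' (i + j + 1)) * X (Var.z' k) *
      pderiv (Var.y (i + k + 1)) (pderiv (Var.z j) f))
    + (∑ᶠ (i : ℕ) (j : ℕ) (k : ℕ), X (Var.y (i + j + 1)) * X (Var.z k) *
      pderiv (Var.y' (i + k + 1)) (pderiv (Var.z' j) f))
    + bb • (∑ᶠ (i : ℕ) (j : ℕ) (k : ℕ), X (Var.y' (i + j + 1)) * X (Var.z' k) *
      pderiv (Var.y' (i + k + 1)) (pderiv (Var.z' j) f))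

/-- `M_Y`: obtained from `M_Z` by exchanging `y ↔ z` and `y′ ↔ z′` everywhere. -/
def MY (f : R) : R :=
  alpha • (∑ᶠ (i : ℕ) (j : ℕ) (k : ℕ), X (Var.z' (i + j + 1)) * X (Var.y' k) *
      pderiv (Var.z (i + k + 1)) (pderiv (Var.y j) f))
    + (∑ᶠ (i : ℕ) (j : ℕ) (k : ℕ), X (Var.z (i + j + 1)) * X (Var.y k) *
      pderiv (Var.z' (i + k + 1)) (pderiv (Var.y' j) f))
    + bb • (∑ᶠ (i : ℕ) (j : ℕ) (k : ℕ), X (Var.z' (i + j + 1)) * X (Var.y' k) *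
      pderiv (Var.z' (i + k + 1)) (pderiv (Var.y' j) f))

/-- `Λ_Ỹ = Λ_Y + Λ_{Y′} + M_Y`. -/
def LamYt (f : R) : R := Lam Var.y f + Lam Var.y' f + MY f

/-- `Λ_Z̃ = Λ_Z + Λ_{Z′} + M_Z`. -/
def LamZt (f : R) : R := Lam Var.z f + Lam Var.z' f + MZ f

/-- `Ỹ_+ = Y_+ + Y′_+`. -/
def Ytplus (f : R) : R := Plus Var.y f + Plus Var.y' f

/-- `Z̃_+ = Z_+ + Z′_+`. -/
def Ztplus (f : R) : R := Plus Var.z f + Plus Var.z' f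

/-- `Θ_Z̃ = ∂/∂z₀ + Σ_{i≥1} p_i ∂/∂z_i + Σ_{i,j≥0} y_{i+j} ∂²/∂y′_i∂z′_j`. -/
def ThZt (f : R) : R :=
  pderiv (Var.z 0) f + (∑ᶠ (i : ℕ), X (Var.p (i + 1)) * pderiv (Var.z (i + 1)) f)
    + (∑ᶠ (i : ℕ) (j : ℕ), X (Var.y (i + j)) * pderiv (Var.y' i) (pderiv (Var.z' j) f))

/-- `Θ_Ỹ = ∂/∂y₀ + Σ_{i≥1} p_i ∂/∂y_i + Σ_{i,j≥0} z_{i+j} ∂²/∂z′_i∂y′_j`. -/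
def ThYt (f : R) : R :=
  pderiv (Var.y 0) f + (∑ᶠ (i : ℕ), X (Var.p (i + 1)) * pderiv (Var.y (i + 1)) f)
    + (∑ᶠ (i : ℕ) (j : ℕ), X (Var.z (i + j)) * pderiv (Var.z' i) (pderiv (Var.y' j) f))

/-- `Δ = α Σ_{i,j≥0} z′_i y′_j ∂²/∂y_i∂z_j + Σ_{i,j≥0} z_i y_j ∂²/∂y′_i∂z′_j
      + b Σ_{i,j≥0} z′_i y′_j ∂²/∂y′_i∂z′_j`. -/
def Delta (f : R) : R :=
  alpha • (∑ᶠ (i : ℕ) (j : ℕ), X (Var.z' i) * X (Var.y' j) *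
      pderiv (Var.y i) (pderiv (Var.z j) f))
    + (∑ᶠ (i : ℕ) (j : ℕ), X (Var.z i) * X (Var.y j) *
      pderiv (Var.y' i) (pderiv (Var.z' j) f))
    + bb • (∑ᶠ (i : ℕ) (j : ℕ), X (Var.z' i) * X (Var.y' j) *
      pderiv (Var.y' i) (pderiv (Var.z' j) f))

/-- `𝒫`: the subalgebra of polynomials in the `p`-variables only. -/
def Psub : Subalgebra K R := MvPolynomial.supported K (Set.range Var.p)

/-- `𝒫_Y`: the `K`-linear span of the monomials `p_λ` and `y_i·p_λ`. -/
def PY : Submodule K R :=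
  Submodule.span K ((Psub : Set R) ∪
    {g : R | ∃ i : ℕ, ∃ f ∈ (Psub : Set R), g = X (Var.y i) * f})

/-- `𝒫_{Ỹ,Z̃}`: the `K`-linear span of the monomials
`p_λ, y_i·p_λ, z_j·p_λ, y_i·z_j·p_λ, y′_i·p_λ, z′_j·p_λ, y′_i·z′_j·p_λ`. -/
def PYZt : Submodule K R :=
  Submodule.span K ((Psub : Set R) ∪
    {g : R | ∃ f ∈ (Psub : Set R),
      (∃ i : ℕ, g = X (Var.y i) * f) ∨ (∃ j : ℕ, g = X (Var.z j) * f) ∨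
      (∃ i : ℕ, ∃ j : ℕ, g = X (Var.y i) * X (Var.z j) * f) ∨
      (∃ i : ℕ, g = X (Var.y' i) * f) ∨ (∃ j : ℕ, g = X (Var.z' j) * f) ∨
      (∃ i : ℕ, ∃ j : ℕ, g = X (Var.y' i) * X (Var.z' j) * f)})

/-- The index of a variable inside its alphabet. -/
def Var.idx : Var → ℕ
  | .p n => n
  | .y n => n
  | .y' n => n
  | .z n => n
  | .z' n => n

/-- `f` only involves variables of index less than `N`. -/
def BoundedBy (N : ℕ) (f : R) : Prop := ∀ v : Var, N ≤ v.idx → pderiv v f = 0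

/-- `f` does not depend on the variables of the alphabet `a`. -/
def FreeOf (a : ℕ → Var) (f : R) : Prop := ∀ i, pderiv (a i) f = 0

theorem exists_boundedBy (f : R) : ∃ N, ∀ M, N ≤ M → BoundedBy M f := by
  refine ⟨f.vars.sup Var.idx + 1, fun M hM v hv => pderiv_eq_zero_of_notMem_vars fun h => ?_⟩
  have := Finset.le_sup (f := Var.idx) h
  omega

theorem BoundedBy.mul {N : ℕ} {f g : R} (hf : BoundedBy N f) (hg : BoundedBy N g) :
    BoundedBy N (f * g) := fun v hv => by
  simp [hf v hv, hg v hv]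

theorem boundedBy_X {N : ℕ} {v : Var} (h : v.idx < N) : BoundedBy N (X v : R) := fun w hw => by
  have : v ≠ w := by rintro rfl; omega
  exact pderiv_X_of_ne this

theorem FreeOf.mul {a : ℕ → Var} {f g : R} (hf : FreeOf a f) (hg : FreeOf a g) :
    FreeOf a (f * g) := fun i => by
  simp [hf i, hg i]

theorem pderiv_pderiv_comm (v w : Var) (f : R) :
    pderiv v (pderiv w f) = pderiv w (pderiv v f) := by
  have h : ⁅(pderiv v : Derivation K R R), (pderiv w : Derivation K R R)⁆ = 0 := by
    refine derivation_ext fun u => ?_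
    by_cases h1 : u = v <;> by_cases h2 : u = w <;>
      simp [Derivation.commutator_apply, pderiv_X, Pi.single_apply, h1, h2, apply_ite]
  have := DFunLike.congr_fun h f
  rwa [Derivation.commutator_apply, Derivation.zero_apply, sub_eq_zero] at this

theorem BoundedBy.pderiv {N : ℕ} {f : R} (hf : BoundedBy N f) (v : Var) :
    BoundedBy N (pderiv v f) := fun w hw => by
  rw [pderiv_pderiv_comm, hf w hw, map_zero]

theorem FreeOf.pderiv {a : ℕ → Var} {f : R} (hf : FreeOf a f) (v : Var) :
    FreeOf a (pderiv v f) := fun i => by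
  rw [pderiv_pderiv_comm, hf i, map_zero]

theorem finsum_eq_sum_range {F : ℕ → R} {N : ℕ} (h : ∀ i, N ≤ i → F i = 0) :
    ∑ᶠ i, F i = ∑ i ∈ Finset.range N, F i := by
  refine finsum_eq_sum_of_support_subset _ fun i hi => ?_
  by_contra hc
  exact hi (h i (by simpa using hc))

theorem finsum₂_eq_sum_range {F : ℕ → ℕ → R} {N : ℕ} (h : ∀ i j, N ≤ i ∨ N ≤ j → F i j = 0) :
    ∑ᶠ (i : ℕ) (j : ℕ), F i j = ∑ i ∈ Finset.range N, ∑ j ∈ Finset.range N, F i j := by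
  rw [finsum_eq_sum_range (N := N) fun i hi => by simp [h i _ (.inl hi)]]
  exact Finset.sum_congr rfl fun i _ => finsum_eq_sum_range fun j hj => h i j (.inr hj)

theorem finsum₃_eq_sum_range {F : ℕ → ℕ → ℕ → R} {N : ℕ}
    (h : ∀ i j k, N ≤ i ∨ N ≤ j ∨ N ≤ k → F i j k = 0) :
    ∑ᶠ (i : ℕ) (j : ℕ) (k : ℕ), F i j k =
      ∑ i ∈ Finset.range N, ∑ j ∈ Finset.range N, ∑ k ∈ Finset.range N, F i j k := by
  rw [finsum_eq_sum_range (N := N) fun i hi => by simp [h i _ _ (.inl hi)]]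
  exact Finset.sum_congr rfl fun i _ => finsum₂_eq_sum_range fun j k hj => h i j k (.inr hj)

/-- An operator that is locally given by linear operators is linear. -/
theorem isLinearMap_of_boundedBy {T : R → R} (S : ℕ → R →ₗ[K] R)
    (h : ∀ N f, BoundedBy N f → T f = S N f) : IsLinearMap K T where
  map_add f g := by
    obtain ⟨N₁, h₁⟩ := exists_boundedBy f
    obtain ⟨N₂, h₂⟩ := exists_boundedBy g
    have hf := h₁ (max N₁ N₂) (le_max_left _ _)
    have hg := h₂ (max N₁ N₂) (le_max_right _ _)
    have hfg : BoundedBy (max N₁ N₂) (f + g) := fun v hv => by simp [hf v hv, hg v hv]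
    rw [h _ _ hf, h _ _ hg, h _ _ hfg, map_add]
  map_smul c f := by
    obtain ⟨N, h₁⟩ := exists_boundedBy f
    have hf := h₁ N le_rfl
    have hcf : BoundedBy N (c • f) := fun v hv => by
      rw [Derivation.map_smul, hf v hv, smul_zero]
    rw [h _ _ hf, h _ _ hcf, map_smul]

theorem IsLinearMap.add' {S T : R → R} (hS : IsLinearMap K S) (hT : IsLinearMap K T) :
    IsLinearMap K fun f => S f + T f :=
  (hS.mk' + hT.mk').isLinear

theorem IsLinearMap.smul' {T : R → R} (c : K) (hT : IsLinearMap K T) :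
    IsLinearMap K fun f => c • T f :=
  (c • hT.mk').isLinear

/-- The operator `Σ_{i,j≥0} u_i v_j ∂²/∂s_i∂t_j`. -/
def quadOp (u v s t : ℕ → Var) (f : R) : R :=
  ∑ᶠ (i : ℕ) (j : ℕ), X (u i) * X (v j) * pderiv (s i) (pderiv (t j) f)

/-- The operator `Σ_{i,j,k≥0} u_{i+j+1} v_k ∂²/∂s_{i+k+1}∂t_j`. -/
def cubicOp (u v s t : ℕ → Var) (f : R) : R :=
  ∑ᶠ (i : ℕ) (j : ℕ) (k : ℕ), X (u (i + j + 1)) * X (v k) *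
    pderiv (s (i + k + 1)) (pderiv (t j) f)

section Operators

variable {a u v s t : ℕ → Var}

theorem quadOp_eq_sum (hs : ∀ n, (s n).idx = n) (ht : ∀ n, (t n).idx = n) {N : ℕ} {f : R}
    (hf : BoundedBy N f) :
    quadOp u v s t f = ∑ i ∈ Finset.range N, ∑ j ∈ Finset.range N,
      X (u i) * X (v j) * pderiv (s i) (pderiv (t j) f) := by
  refine finsum₂_eq_sum_range fun i j h => ?_
  rcases h with h | h
  · rw [hf.pderiv _ _ (by rwa [hs]), mul_zero]
  · rw [hf _ (by rwa [ht]), map_zero, mul_zero]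

theorem cubicOp_eq_sum (hs : ∀ n, (s n).idx = n) (ht : ∀ n, (t n).idx = n) {N : ℕ} {f : R}
    (hf : BoundedBy N f) :
    cubicOp u v s t f = ∑ i ∈ Finset.range N, ∑ j ∈ Finset.range N, ∑ k ∈ Finset.range N,
      X (u (i + j + 1)) * X (v k) * pderiv (s (i + k + 1)) (pderiv (t j) f) := by
  refine finsum₃_eq_sum_range fun i j k h => ?_
  rcases h with h | h | h
  · rw [hf.pderiv _ _ (by rw [hs]; omega), mul_zero]
  · rw [hf _ (by rwa [ht]), map_zero, mul_zero]
  · rw [hf.pderiv _ _ (by rw [hs]; omega), mul_zero]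

theorem Lam_eq_sum (ha : ∀ n, (a n).idx = n) {N : ℕ} {f : R} (hf : BoundedBy N f) :
    Lam a f =
      alpha • (∑ i ∈ Finset.range N, ∑ j ∈ Finset.range N, ((i + 1 : ℕ) : K) •
        (X (a (i + j + 1)) * pderiv (Var.p (i + 1)) (pderiv (a j) f)))
      + (∑ i ∈ Finset.range N, ∑ j ∈ Finset.range N,
        X (a i) * X (Var.p (j + 1)) * pderiv (a (i + j + 1)) f)
      + bb • (∑ i ∈ Finset.range N,
        ((i + 1 : ℕ) : K) • (X (a (i + 1)) * pderiv (a (i + 1)) f)) := by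
  unfold Lam
  rw [finsum₂_eq_sum_range (N := N), finsum₂_eq_sum_range (N := N), finsum_eq_sum_range (N := N)]
  · intro i hi
    rw [hf _ (by rw [ha]; omega), mul_zero, smul_zero]
  · intro i j h
    rw [hf _ (by rw [ha]; omega), mul_zero]
  · intro i j h
    rcases h with h | h
    · rw [hf.pderiv _ _ (by simp only [Var.idx]; omega), mul_zero, smul_zero]
    · rw [hf _ (by rwa [ha]), map_zero, mul_zero, smul_zero]

theorem isLinearMap_quadOp (hs : ∀ n, (s n).idx = n) (ht : ∀ n, (t n).idx = n) :
    IsLinearMap K (quadOp u v s t) := by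
  refine isLinearMap_of_boundedBy (fun N => ∑ i ∈ Finset.range N, ∑ j ∈ Finset.range N,
      LinearMap.mulLeft K (X (u i) * X (v j) : R) ∘ₗ (pderiv (s i)).toLinearMap ∘ₗ
        (pderiv (t j)).toLinearMap) fun N f hf => ?_
  simp [quadOp_eq_sum hs ht hf, LinearMap.sum_apply, mul_assoc]

theorem isLinearMap_cubicOp (hs : ∀ n, (s n).idx = n) (ht : ∀ n, (t n).idx = n) :
    IsLinearMap K (cubicOp u v s t) := by
  refine isLinearMap_of_boundedBy (fun N => ∑ i ∈ Finset.range N, ∑ j ∈ Finset.range N,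
      ∑ k ∈ Finset.range N, LinearMap.mulLeft K (X (u (i + j + 1)) * X (v k) : R) ∘ₗ
        (pderiv (s (i + k + 1))).toLinearMap ∘ₗ (pderiv (t j)).toLinearMap) fun N f hf => ?_
  simp [cubicOp_eq_sum hs ht hf, LinearMap.sum_apply, mul_assoc]

theorem isLinearMap_Lam (ha : ∀ n, (a n).idx = n) : IsLinearMap K (Lam a) := by
  refine isLinearMap_of_boundedBy (fun N =>
      alpha • (∑ i ∈ Finset.range N, ∑ j ∈ Finset.range N, ((i + 1 : ℕ) : K) •
        (LinearMap.mulLeft K (X (a (i + j + 1)) : R) ∘ₗ (pderiv (Var.p (i + 1))).toLinearMap ∘ₗ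
          (pderiv (a j)).toLinearMap))
      + (∑ i ∈ Finset.range N, ∑ j ∈ Finset.range N,
        LinearMap.mulLeft K (X (a i) * X (Var.p (j + 1)) : R) ∘ₗ
          (pderiv (a (i + j + 1))).toLinearMap)
      + bb • (∑ i ∈ Finset.range N, ((i + 1 : ℕ) : K) •
        (LinearMap.mulLeft K (X (a (i + 1)) : R) ∘ₗ (pderiv (a (i + 1))).toLinearMap)))
    fun N f hf => ?_
  simp only [Lam_eq_sum ha hf, LinearMap.sum_apply, LinearMap.add_apply, LinearMap.smul_apply,
    LinearMap.comp_apply, LinearMap.mulLeft_apply, Derivation.coeFn_coe]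

theorem pderiv_X_alphabet (ha : ∀ n, (a n).idx = n) (i n : ℕ) :
    pderiv (a i) (X (a n) : R) = if i = n then 1 else 0 := by
  split_ifs with h
  · rw [h, pderiv_X_self]
  · refine pderiv_X_of_ne fun h' => h ?_
    rw [← ha i, ← ha n, h']

theorem freeOf_X {v : Var} (h : ∀ i, v ≠ a i) : FreeOf a (X v : R) :=
  fun i => pderiv_X_of_ne (h i)

theorem quadOp_eq_zero {f : R} (h : FreeOf s f ∨ FreeOf t f) : quadOp u v s t f = 0 := by
  have : ∀ i j, pderiv (s i) (pderiv (t j) f) = 0 := fun i j => by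
    rcases h with h | h
    · rw [h.pderiv]
    · rw [h, map_zero]
  simp [quadOp, this]

theorem cubicOp_eq_zero {f : R} (h : FreeOf s f ∨ FreeOf t f) : cubicOp u v s t f = 0 := by
  have : ∀ i j, pderiv (s i) (pderiv (t j) f) = 0 := fun i j => by
    rcases h with h | h
    · rw [h.pderiv]
    · rw [h, map_zero]
  simp [cubicOp, this]

theorem Lam_eq_zero {f : R} (h : FreeOf a f) : Lam a f = 0 := by
  simp [Lam, h _]

theorem pderiv_pderiv_X_mul_X_mul (hs : ∀ n, (s n).idx = n) (ht : ∀ n, (t n).idx = n)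
    (hst : ∀ i j, s i ≠ t j) {q : R} (hsq : FreeOf s q) (htq : FreeOf t q) (i j m n : ℕ) :
    pderiv (s i) (pderiv (t j) (X (s m) * X (t n) * q)) =
      if j = n then if i = m then q else 0 else 0 := by
  have h : pderiv (t j) (X (s m) * X (t n) * q) = if j = n then X (s m) * q else 0 := by
    rw [pderiv_mul, pderiv_mul, freeOf_X (fun i => hst m i) j, htq j, pderiv_X_alphabet ht]
    split_ifs <;> simp
  rw [h]
  split_ifs with h1 h2
  · rw [pderiv_mul, hsq i, pderiv_X_alphabet hs, if_pos h2]; simp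
  · rw [pderiv_mul, hsq i, pderiv_X_alphabet hs, if_neg h2]; simp
  · simp

theorem quadOp_X_mul_X_mul (hs : ∀ n, (s n).idx = n) (ht : ∀ n, (t n).idx = n)
    (hst : ∀ i j, s i ≠ t j) {q : R} (hsq : FreeOf s q) (htq : FreeOf t q) (m n : ℕ) :
    quadOp u v s t (X (s m) * X (t n) * q) = X (u m) * X (v n) * q := by
  obtain ⟨N₀, hN₀⟩ := exists_boundedBy (X (s m) * X (t n) * q)
  have hN : BoundedBy (N₀ + m + n + 1) (X (s m) * X (t n) * q) := hN₀ _ (by omega)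
  have hm : m ∈ Finset.range (N₀ + m + n + 1) := Finset.mem_range.2 (by omega)
  have hn : n ∈ Finset.range (N₀ + m + n + 1) := Finset.mem_range.2 (by omega)
  simp only [quadOp_eq_sum hs ht hN, pderiv_pderiv_X_mul_X_mul hs ht hst hsq htq]
  rw [Finset.sum_eq_single_of_mem m hm, Finset.sum_eq_single_of_mem n hn]
  · simp
  · intro j _ hj
    simp [hj]
  · intro i _ hi
    simp [hi]

theorem cubicOp_X_mul_X_mul (hs : ∀ n, (s n).idx = n) (ht : ∀ n, (t n).idx = n)
    (hst : ∀ i j, s i ≠ t j) {q : R} (hsq : FreeOf s q) (htq : FreeOf t q) {N m n : ℕ}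
    (hq : BoundedBy N q) (hm : m < N) (hn : n < N) :
    cubicOp u v s t (X (s m) * X (t n) * q) =
      ∑ i ∈ Finset.range N, ∑ k ∈ Finset.range N, (if i + k + 1 = m then 1 else 0 : K) •
        (X (u (i + n + 1)) * X (v k) * q) := by
  have hN : BoundedBy N (X (s m) * X (t n) * q) :=
    ((boundedBy_X (by rwa [hs])).mul (boundedBy_X (by rwa [ht]))).mul hq
  simp only [cubicOp_eq_sum hs ht hN,
    pderiv_pderiv_X_mul_X_mul hs ht hst hsq htq]
  refine Finset.sum_congr rfl fun i _ => ?_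
  rw [Finset.sum_eq_single_of_mem n (Finset.mem_range.2 hn)]
  · refine Finset.sum_congr rfl fun k _ => ?_
    rw [if_pos rfl]
    split_ifs <;> simp
  · intro j _ hj
    simp [hj]

theorem Lam_X_mul (ha : ∀ n, (a n).idx = n) {c : R}
    (hac : FreeOf a c) {N n : ℕ} (hc : BoundedBy N c) (hn : n < N) :
    Lam a (X (a n) * c) =
      alpha • (∑ i ∈ Finset.range N, ((i + 1 : ℕ) : K) •
        (X (a (i + n + 1)) * pderiv (Var.p (i + 1)) c))
      + (∑ i ∈ Finset.range N, ∑ j ∈ Finset.range N, (if i + j + 1 = n then 1 else 0 : K) •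
        (X (a i) * (X (Var.p (j + 1)) * c)))
      + bb • ((n : K) • (X (a n) * c)) := by
  have hN : BoundedBy N (X (a n) * c) := (boundedBy_X (by rwa [ha])).mul hc
  have hd : ∀ i, pderiv (a i) (X (a n) * c) = if i = n then c else 0 := fun i => by
    rw [pderiv_mul, hac i, pderiv_X_alphabet ha]
    split_ifs <;> simp
  rw [Lam_eq_sum ha hN]
  simp only [hd]
  congr 1
  · congr 1
    · congr 1
      refine Finset.sum_congr rfl fun i _ => ?_
      rw [Finset.sum_eq_single_of_mem n (Finset.mem_range.2 hn)]
      · simp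
      · intro j _ hj
        simp [hj]
    · refine Finset.sum_congr rfl fun i _ => Finset.sum_congr rfl fun j _ => ?_
      split_ifs <;> simp [mul_assoc]
  · congr 1
    cases n with
    | zero => simp
    | succ n =>
      rw [Finset.sum_eq_single_of_mem n (Finset.mem_range.2 (by omega))]
      · simp
      · intro j _ hj
        simp [hj]

theorem Lam_X_mul_X_mul (hs : ∀ n, (s n).idx = n) (ht : ∀ n, (t n).idx = n)
    (htp : ∀ i j, t i ≠ Var.p j) (hst : ∀ i j, s i ≠ t j) {q : R}
    (hq : FreeOf s q) {N m n : ℕ} (hN : BoundedBy N q) (hm : m < N) (hn : n < N) :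
    Lam s (X (s m) * X (t n) * q) =
      alpha • (∑ i ∈ Finset.range N, ((i + 1 : ℕ) : K) •
        (X (s (i + m + 1)) * X (t n) * pderiv (Var.p (i + 1)) q))
      + (∑ i ∈ Finset.range N, ∑ j ∈ Finset.range N, (if i + j + 1 = m then 1 else 0 : K) •
        (X (s i) * X (t n) * (X (Var.p (j + 1)) * q)))
      + bb • ((m : K) • (X (s m) * X (t n) * q)) := by
  have hd : ∀ i, pderiv (Var.p i) (X (t n) * q) = X (t n) * pderiv (Var.p i) q := fun i => by
    rw [pderiv_mul, pderiv_X_of_ne (htp n i)]; simp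
  rw [mul_assoc, Lam_X_mul hs ((freeOf_X fun i => (hst i n).symm).mul hq)
    ((boundedBy_X (by rwa [ht])).mul hN) hm]
  simp only [hd, mul_assoc, mul_left_comm (X (Var.p _)) (X (t n))]

end Operators

theorem Delta_eq_quadOp (f : R) : Delta f =
    alpha • quadOp Var.z' Var.y' Var.y Var.z f + quadOp Var.z Var.y Var.y' Var.z' f
      + bb • quadOp Var.z' Var.y' Var.y' Var.z' f := rfl

theorem MZ_eq_cubicOp (f : R) : MZ f =
    alpha • cubicOp Var.y' Var.z' Var.y Var.z f + cubicOp Var.y Var.z Var.y' Var.z' f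
      + bb • cubicOp Var.y' Var.z' Var.y' Var.z' f := rfl

theorem MY_eq_cubicOp (f : R) : MY f =
    alpha • cubicOp Var.z' Var.y' Var.z Var.y f + cubicOp Var.z Var.y Var.z' Var.y' f
      + bb • cubicOp Var.z' Var.y' Var.z' Var.y' f := rfl

theorem isLinearMap_Delta : IsLinearMap K Delta :=
  (((isLinearMap_quadOp (fun _ => rfl) fun _ => rfl).smul' alpha).add'
    (isLinearMap_quadOp (fun _ => rfl) fun _ => rfl)).add'
    ((isLinearMap_quadOp (fun _ => rfl) fun _ => rfl).smul' bb)

theorem isLinearMap_MZ : IsLinearMap K MZ :=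
  (((isLinearMap_cubicOp (fun _ => rfl) fun _ => rfl).smul' alpha).add'
    (isLinearMap_cubicOp (fun _ => rfl) fun _ => rfl)).add'
    ((isLinearMap_cubicOp (fun _ => rfl) fun _ => rfl).smul' bb)

theorem isLinearMap_MY : IsLinearMap K MY :=
  (((isLinearMap_cubicOp (fun _ => rfl) fun _ => rfl).smul' alpha).add'
    (isLinearMap_cubicOp (fun _ => rfl) fun _ => rfl)).add'
    ((isLinearMap_cubicOp (fun _ => rfl) fun _ => rfl).smul' bb)

theorem isLinearMap_LamZt : IsLinearMap K LamZt :=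
  ((isLinearMap_Lam fun _ => rfl).add' (isLinearMap_Lam fun _ => rfl)).add' isLinearMap_MZ

theorem isLinearMap_LamYt : IsLinearMap K LamYt :=
  ((isLinearMap_Lam fun _ => rfl).add' (isLinearMap_Lam fun _ => rfl)).add' isLinearMap_MY

/-- `f` involves no variable of the alphabets `y, y′` or no variable of the alphabets `z, z′`. -/
def OneSided (f : R) : Prop :=
  (FreeOf Var.y f ∧ FreeOf Var.y' f) ∨ (FreeOf Var.z f ∧ FreeOf Var.z' f)

theorem OneSided.Delta_eq_zero {f : R} (h : OneSided f) : Delta f = 0 := by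
  rcases h with ⟨h, h'⟩ | ⟨h, h'⟩ <;> simp [Delta_eq_quadOp, quadOp_eq_zero, h, h']

theorem OneSided.MY_eq_zero {f : R} (h : OneSided f) : MY f = 0 := by
  rcases h with ⟨h, h'⟩ | ⟨h, h'⟩ <;> simp [MY_eq_cubicOp, cubicOp_eq_zero, h, h']

theorem FreeOf.of_mem_Psub {a : ℕ → Var} {q : R} (hq : q ∈ Psub)
    (ha : ∀ i j, a i ≠ Var.p j := by simp) : FreeOf a q := fun i => by
  refine pderiv_eq_zero_of_notMem_vars fun h => ?_
  obtain ⟨j, hj⟩ := mem_supported.1 hq h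
  exact ha i j hj.symm

theorem FreeOf.Lam {a e : ℕ → Var} (ha : ∀ n, (a n).idx = n) (hae : ∀ i j, a i ≠ e j)
    (hpe : ∀ i j, Var.p i ≠ e j) {f : R} (hf : FreeOf e f) : FreeOf e (Lam a f) := fun i => by
  obtain ⟨N, hN⟩ := exists_boundedBy f
  rw [Lam_eq_sum ha (hN N le_rfl)]
  simp only [map_add, Derivation.map_smul, map_sum, pderiv_mul, pderiv_X_of_ne (hae _ i),
    pderiv_X_of_ne (hpe _ i), (hf.pderiv _) i, ((hf.pderiv _).pderiv _) i]
  simp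

theorem OneSided.Delta_LamYt_eq_zero {f : R} (h : OneSided f) : Delta (LamYt f) = 0 := by
  rw [LamYt, h.MY_eq_zero, add_zero]
  rcases h with ⟨h, h'⟩ | ⟨h, h'⟩
  · rw [Lam_eq_zero h, Lam_eq_zero h', add_zero, isLinearMap_Delta.map_zero]
  · rw [isLinearMap_Delta.map_add, OneSided.Delta_eq_zero, OneSided.Delta_eq_zero, add_zero] <;>
      exact Or.inr ⟨FreeOf.Lam (fun _ => rfl) (by simp) (by simp) h,
        FreeOf.Lam (fun _ => rfl) (by simp) (by simp) h'⟩

theorem OneSided.LamZt_Delta {f : R} (h : OneSided f) : LamZt (Delta f) = Delta (LamYt f) := by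
  rw [h.Delta_LamYt_eq_zero, h.Delta_eq_zero, isLinearMap_LamZt.map_zero]

theorem Delta_y_z {q : R} (hq : q ∈ Psub) (m n : ℕ) :
    Delta (X (Var.y m) * X (Var.z n) * q) = alpha • (X (Var.y' n) * X (Var.z' m) * q) := by
  rw [Delta_eq_quadOp, quadOp_X_mul_X_mul (fun _ => rfl) (fun _ => rfl) (by simp)
    (.of_mem_Psub hq) (.of_mem_Psub hq), quadOp_eq_zero, quadOp_eq_zero, smul_zero, add_zero,
    add_zero, mul_comm (X (Var.z' m))]
  all_goals exact .inl (((freeOf_X (by simp)).mul (freeOf_X (by simp))).mul (.of_mem_Psub hq))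

theorem Delta_y'_z' {q : R} (hq : q ∈ Psub) (m n : ℕ) :
    Delta (X (Var.y' m) * X (Var.z' n) * q) =
      X (Var.y n) * X (Var.z m) * q + bb • (X (Var.y' n) * X (Var.z' m) * q) := by
  rw [Delta_eq_quadOp, quadOp_eq_zero (s := Var.y), quadOp_X_mul_X_mul (fun _ => rfl)
    (fun _ => rfl) (by simp) (.of_mem_Psub hq) (.of_mem_Psub hq), quadOp_X_mul_X_mul (fun _ => rfl)
    (fun _ => rfl) (by simp) (.of_mem_Psub hq) (.of_mem_Psub hq), smul_zero, zero_add,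
    mul_comm (X (Var.z' m)), mul_comm (X (Var.z m))]
  exact .inl (((freeOf_X (by simp)).mul (freeOf_X (by simp))).mul (.of_mem_Psub hq))

theorem LamYt_y_z {q : R} (hq : q ∈ Psub) {N m n : ℕ} (hN : BoundedBy N q)
    (hm : m < N) (hn : n < N) : LamYt (X (Var.y m) * X (Var.z n) * q) =
    alpha • (∑ i ∈ Finset.range N, ((i + 1 : ℕ) : K) •
        (X (Var.y (i + m + 1)) * X (Var.z n) * pderiv (Var.p (i + 1)) q))
      + (∑ i ∈ Finset.range N, ∑ j ∈ Finset.range N, (if i + j + 1 = m then 1 else 0 : K) •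
        (X (Var.y i) * X (Var.z n) * (X (Var.p (j + 1)) * q)))
      + bb • ((m : K) • (X (Var.y m) * X (Var.z n) * q))
      + alpha • (∑ i ∈ Finset.range N, ∑ k ∈ Finset.range N,
        (if i + k + 1 = n then 1 else 0 : K) •
          (X (Var.y' k) * X (Var.z' (i + m + 1)) * q)) := by
  have hf : ∀ a : ℕ → Var, (∀ i j, Var.y i ≠ a j) → (∀ i j, Var.z i ≠ a j) →
      (∀ i j, a i ≠ Var.p j) → FreeOf a (X (Var.y m) * X (Var.z n) * q) := fun a h1 h2 h3 =>
    ((freeOf_X (h1 m)).mul (freeOf_X (h2 n))).mul (.of_mem_Psub hq h3)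
  rw [LamYt, Lam_X_mul_X_mul (fun _ => rfl) (fun _ => rfl) (by simp) (by simp) (.of_mem_Psub hq)
    hN hm hn, Lam_eq_zero (hf _ (by simp) (by simp) (by simp)), MY_eq_cubicOp,
    cubicOp_eq_zero (s := Var.z') (.inl (hf _ (by simp) (by simp) (by simp))),
    cubicOp_eq_zero (s := Var.z') (.inl (hf _ (by simp) (by simp) (by simp))),
    mul_comm (X (Var.y m)) (X (Var.z n)), cubicOp_X_mul_X_mul (fun _ => rfl) (fun _ => rfl)
    (by simp) (.of_mem_Psub hq) (.of_mem_Psub hq) hN hn hm]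
  simp only [mul_comm (X (Var.z' _)) (X (Var.y' _)), mul_comm (X (Var.z _)) (X (Var.y _)),
    add_zero, smul_zero]

theorem LamZt_y_z {q : R} (hq : q ∈ Psub) {N m n : ℕ} (hN : BoundedBy N q)
    (hm : m < N) (hn : n < N) : LamZt (X (Var.y m) * X (Var.z n) * q) =
    alpha • (∑ i ∈ Finset.range N, ((i + 1 : ℕ) : K) •
        (X (Var.y m) * X (Var.z (i + n + 1)) * pderiv (Var.p (i + 1)) q))
      + (∑ i ∈ Finset.range N, ∑ j ∈ Finset.range N, (if i + j + 1 = n then 1 else 0 : K) •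
        (X (Var.y m) * X (Var.z i) * (X (Var.p (j + 1)) * q)))
      + bb • ((n : K) • (X (Var.y m) * X (Var.z n) * q))
      + alpha • (∑ i ∈ Finset.range N, ∑ k ∈ Finset.range N,
        (if i + k + 1 = m then 1 else 0 : K) •
          (X (Var.y' (i + n + 1)) * X (Var.z' k) * q)) := by
  have hf : ∀ a : ℕ → Var, (∀ i j, Var.y i ≠ a j) → (∀ i j, Var.z i ≠ a j) →
      (∀ i j, a i ≠ Var.p j) → FreeOf a (X (Var.y m) * X (Var.z n) * q) := fun a h1 h2 h3 =>
    ((freeOf_X (h1 m)).mul (freeOf_X (h2 n))).mul (.of_mem_Psub hq h3)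
  rw [LamZt, Lam_eq_zero (a := Var.z') (hf _ (by simp) (by simp) (by simp)), MZ_eq_cubicOp,
    cubicOp_eq_zero (s := Var.y') (.inl (hf _ (by simp) (by simp) (by simp))),
    cubicOp_eq_zero (s := Var.y') (.inl (hf _ (by simp) (by simp) (by simp))),
    cubicOp_X_mul_X_mul (fun _ => rfl) (fun _ => rfl)
    (by simp) (.of_mem_Psub hq) (.of_mem_Psub hq) hN hm hn, mul_comm (X (Var.y m)) (X (Var.z n)),
    Lam_X_mul_X_mul (fun _ => rfl) (fun _ => rfl) (by simp) (by simp) (.of_mem_Psub hq) hN hn hm]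
  simp only [mul_comm (X (Var.z _)) (X (Var.y _)), add_zero, smul_zero]

theorem LamYt_y'_z' {q : R} (hq : q ∈ Psub) {N m n : ℕ} (hN : BoundedBy N q)
    (hm : m < N) (hn : n < N) : LamYt (X (Var.y' m) * X (Var.z' n) * q) =
    alpha • (∑ i ∈ Finset.range N, ((i + 1 : ℕ) : K) •
        (X (Var.y' (i + m + 1)) * X (Var.z' n) * pderiv (Var.p (i + 1)) q))
      + (∑ i ∈ Finset.range N, ∑ j ∈ Finset.range N, (if i + j + 1 = m then 1 else 0 : K) •
        (X (Var.y' i) * X (Var.z' n) * (X (Var.p (j + 1)) * q)))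
      + bb • ((m : K) • (X (Var.y' m) * X (Var.z' n) * q))
      + ((∑ i ∈ Finset.range N, ∑ k ∈ Finset.range N, (if i + k + 1 = n then 1 else 0 : K) •
          (X (Var.y k) * X (Var.z (i + m + 1)) * q))
        + bb • (∑ i ∈ Finset.range N, ∑ k ∈ Finset.range N,
          (if i + k + 1 = n then 1 else 0 : K) •
            (X (Var.y' k) * X (Var.z' (i + m + 1)) * q))) := by
  have hf : ∀ a : ℕ → Var, (∀ i j, Var.y' i ≠ a j) → (∀ i j, Var.z' i ≠ a j) →
      (∀ i j, a i ≠ Var.p j) → FreeOf a (X (Var.y' m) * X (Var.z' n) * q) := fun a h1 h2 h3 =>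
    ((freeOf_X (h1 m)).mul (freeOf_X (h2 n))).mul (.of_mem_Psub hq h3)
  rw [LamYt, Lam_X_mul_X_mul (s := Var.y') (fun _ => rfl) (fun _ => rfl) (by simp) (by simp)
    (.of_mem_Psub hq) hN hm hn, Lam_eq_zero (hf _ (by simp) (by simp) (by simp)), MY_eq_cubicOp,
    cubicOp_eq_zero (s := Var.z) (.inl (hf _ (by simp) (by simp) (by simp))),
    mul_comm (X (Var.y' m)) (X (Var.z' n)), cubicOp_X_mul_X_mul (fun _ => rfl) (fun _ => rfl)
    (by simp) (.of_mem_Psub hq) (.of_mem_Psub hq) hN hn hm, cubicOp_X_mul_X_mul (fun _ => rfl)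
    (fun _ => rfl) (by simp) (.of_mem_Psub hq) (.of_mem_Psub hq) hN hn hm]
  simp only [mul_comm (X (Var.z' _)) (X (Var.y' _)), mul_comm (X (Var.z _)) (X (Var.y _)),
    zero_add, smul_zero]

theorem LamZt_y'_z' {q : R} (hq : q ∈ Psub) {N m n : ℕ} (hN : BoundedBy N q)
    (hm : m < N) (hn : n < N) : LamZt (X (Var.y' m) * X (Var.z' n) * q) =
    alpha • (∑ i ∈ Finset.range N, ((i + 1 : ℕ) : K) •
        (X (Var.y' m) * X (Var.z' (i + n + 1)) * pderiv (Var.p (i + 1)) q))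
      + (∑ i ∈ Finset.range N, ∑ j ∈ Finset.range N, (if i + j + 1 = n then 1 else 0 : K) •
        (X (Var.y' m) * X (Var.z' i) * (X (Var.p (j + 1)) * q)))
      + bb • ((n : K) • (X (Var.y' m) * X (Var.z' n) * q))
      + ((∑ i ∈ Finset.range N, ∑ k ∈ Finset.range N, (if i + k + 1 = m then 1 else 0 : K) •
          (X (Var.y (i + n + 1)) * X (Var.z k) * q))
        + bb • (∑ i ∈ Finset.range N, ∑ k ∈ Finset.range N,
          (if i + k + 1 = m then 1 else 0 : K) •
            (X (Var.y' (i + n + 1)) * X (Var.z' k) * q))) := by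
  have hf : ∀ a : ℕ → Var, (∀ i j, Var.y' i ≠ a j) → (∀ i j, Var.z' i ≠ a j) →
      (∀ i j, a i ≠ Var.p j) → FreeOf a (X (Var.y' m) * X (Var.z' n) * q) := fun a h1 h2 h3 =>
    ((freeOf_X (h1 m)).mul (freeOf_X (h2 n))).mul (.of_mem_Psub hq h3)
  rw [LamZt, Lam_eq_zero (a := Var.z) (hf _ (by simp) (by simp) (by simp)), MZ_eq_cubicOp,
    cubicOp_eq_zero (s := Var.y) (.inl (hf _ (by simp) (by simp) (by simp))),
    cubicOp_X_mul_X_mul (fun _ => rfl) (fun _ => rfl)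
    (by simp) (.of_mem_Psub hq) (.of_mem_Psub hq) hN hm hn,
    cubicOp_X_mul_X_mul (fun _ => rfl) (fun _ => rfl)
    (by simp) (.of_mem_Psub hq) (.of_mem_Psub hq) hN hm hn, mul_comm (X (Var.y' m)) (X (Var.z' n)),
    Lam_X_mul_X_mul (fun _ => rfl) (fun _ => rfl) (by simp) (by simp) (.of_mem_Psub hq) hN hn hm]
  simp only [mul_comm (X (Var.z' _)) (X (Var.y' _)), zero_add, smul_zero]

theorem X_p_mul_mem_Psub {q : R} (hq : q ∈ Psub) (j : ℕ) : X (Var.p j) * q ∈ Psub :=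
  Psub.mul_mem (X_mem_supported.2 ⟨j, rfl⟩) hq

theorem pderiv_mem_Psub {q : R} (hq : q ∈ Psub) (v : Var) : pderiv v q ∈ Psub := by
  refine Algebra.adjoin_induction (p := fun f _ => pderiv v f ∈ Psub) ?_ ?_ ?_ ?_ hq
  · rintro _ ⟨w, _, rfl⟩
    by_cases h : w = v
    · rw [h, pderiv_X_self]
      exact Psub.one_mem
    · rw [pderiv_X_of_ne h]
      exact Psub.zero_mem
  · intro c
    rw [algebraMap_eq, pderiv_C]
    exact Psub.zero_mem
  · intro f g _ _ hf hg
    rw [map_add]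
    exact Psub.add_mem hf hg
  · intro f g hf' hg' hf hg
    rw [pderiv_mul]
    exact Psub.add_mem (Psub.mul_mem hf hg') (Psub.mul_mem hf' hg)

theorem IsLinearMap.map_sum' {T : R → R} (hT : IsLinearMap K T) (s : Finset ℕ) (F : ℕ → R) :
    T (∑ i ∈ s, F i) = ∑ i ∈ s, T (F i) :=
  map_sum hT.mk' F s

theorem LamZt_Delta_y_z {q : R} (hq : q ∈ Psub) (m n : ℕ) :
    LamZt (Delta (X (Var.y m) * X (Var.z n) * q)) =
      Delta (LamYt (X (Var.y m) * X (Var.z n) * q)) := by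
  obtain ⟨N₀, hN₀⟩ := exists_boundedBy q
  obtain ⟨N, hN, hm, hn⟩ : ∃ N, BoundedBy N q ∧ m < N ∧ n < N :=
    ⟨N₀ + m + n + 1, hN₀ _ (by omega), by omega, by omega⟩
  rw [Delta_y_z hq, isLinearMap_LamZt.map_smul, LamZt_y'_z' hq hN hn hm, LamYt_y_z hq hN hm hn]
  simp only [isLinearMap_Delta.map_add, isLinearMap_Delta.map_smul,
    isLinearMap_Delta.map_sum', Delta_y_z hq, Delta_y'_z' hq,
    Delta_y_z (X_p_mul_mem_Psub hq _), Delta_y_z (pderiv_mem_Psub hq _)]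
  simp only [smul_add, Finset.smul_sum, Finset.sum_add_distrib, smul_smul, mul_comm,
    mul_left_comm]

theorem LamZt_Delta_y'_z' {q : R} (hq : q ∈ Psub) (m n : ℕ) :
    LamZt (Delta (X (Var.y' m) * X (Var.z' n) * q)) =
      Delta (LamYt (X (Var.y' m) * X (Var.z' n) * q)) := by
  obtain ⟨N₀, hN₀⟩ := exists_boundedBy q
  obtain ⟨N, hN, hm, hn⟩ : ∃ N, BoundedBy N q ∧ m < N ∧ n < N :=
    ⟨N₀ + m + n + 1, hN₀ _ (by omega), by omega, by omega⟩
  rw [Delta_y'_z' hq, isLinearMap_LamZt.map_add, isLinearMap_LamZt.map_smul,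
    LamZt_y_z hq hN hn hm, LamZt_y'_z' hq hN hn hm, LamYt_y'_z' hq hN hm hn]
  simp only [isLinearMap_Delta.map_add, isLinearMap_Delta.map_smul,
    isLinearMap_Delta.map_sum', Delta_y_z hq, Delta_y'_z' hq,
    Delta_y'_z' (X_p_mul_mem_Psub hq _), Delta_y'_z' (pderiv_mem_Psub hq _)]
  simp only [smul_add, Finset.smul_sum, Finset.sum_add_distrib, smul_smul, mul_comm,
    mul_left_comm]
  abel

/-- `Λ_Z̃ Δ = Δ Λ_Ỹ` on `𝒫_{Ỹ,Z̃}` (relation (4.7a) of Chapuy–Dołęga). -/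
theorem LamZt_Delta_eq_Delta_LamYt :
    ∀ f ∈ PYZt, LamZt (Delta f) = Delta (LamYt f) := by
  intro f hf
  refine Submodule.span_induction (p := fun f _ => LamZt (Delta f) = Delta (LamYt f))
    ?_ ?_ ?_ ?_ hf
  · rintro _ (hq | ⟨q, hq, ⟨i, rfl⟩ | ⟨j, rfl⟩ | ⟨i, j, rfl⟩ | ⟨i, rfl⟩ | ⟨j, rfl⟩ | ⟨i, j, rfl⟩⟩)
    · exact OneSided.LamZt_Delta (.inl ⟨.of_mem_Psub hq, .of_mem_Psub hq⟩)
    · exact OneSided.LamZt_Delta (.inr ⟨(freeOf_X (by simp)).mul (.of_mem_Psub hq),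
        (freeOf_X (by simp)).mul (.of_mem_Psub hq)⟩)
    · exact OneSided.LamZt_Delta (.inl ⟨(freeOf_X (by simp)).mul (.of_mem_Psub hq),
        (freeOf_X (by simp)).mul (.of_mem_Psub hq)⟩)
    · exact LamZt_Delta_y_z hq i j
    · exact OneSided.LamZt_Delta (.inr ⟨(freeOf_X (by simp)).mul (.of_mem_Psub hq),
        (freeOf_X (by simp)).mul (.of_mem_Psub hq)⟩)
    · exact OneSided.LamZt_Delta (.inl ⟨(freeOf_X (by simp)).mul (.of_mem_Psub hq),
        (freeOf_X (by simp)).mul (.of_mem_Psub hq)⟩)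
    · exact LamZt_Delta_y'_z' hq i j
  · rw [isLinearMap_Delta.map_zero, isLinearMap_LamYt.map_zero, isLinearMap_LamZt.map_zero,
      isLinearMap_Delta.map_zero]
  · intro f g _ _ h₁ h₂
    rw [isLinearMap_Delta.map_add, isLinearMap_LamYt.map_add, isLinearMap_LamZt.map_add,
      isLinearMap_Delta.map_add, h₁, h₂]
  · intro c f _ h
    rw [isLinearMap_Delta.map_smul, isLinearMap_LamYt.map_smul, isLinearMap_LamZt.map_smul,
      isLinearMap_Delta.map_smul, h]
end
end

section
/- Fourfold exchange identity: (Λ_Z̃+Δ)Λ_Ỹ = Λ_Ỹ(Λ_Z̃+Δ) = (Λ_Ỹ+Δ)Λ_Z̃ = Λ_Z̃(Λ_Ỹ+Δ) on 𝒫_{Ỹ,Z̃}, i.e. for every f ∈ 𝒫_{Ỹ,Z̃} the four elements (Λ_Z̃+Δ)(Λ_Ỹ f), Λ_Ỹ((Λ_Z̃+Δ) f), (Λ_Ỹ+Δ)(Λ_Z̃ f), Λ_Z̃((Λ_Ỹ+Δ) f) of R′ are all equal (where Λ+Δ denotes the pointwise sum of the two operators). -/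
open MvPolynomial

noncomputable section

section ModelAndTransfer

open Filter

section LocallyFinite
variable {k M N : Type*} [CommRing k] [AddCommGroup M] [Module k M] [AddCommGroup N] [Module k N]

/-- A sequence of linear maps is locally finite if on each vector only finitely many act
nontrivially. -/
def LocFin (T : ℕ → M →ₗ[k] N) : Prop := ∀ w, ∀ᶠ i in atTop, T i w = 0

theorem LocFin.eventually_finsum {T : ℕ → M →ₗ[k] N} (h : LocFin T) (w : M) :
    ∀ᶠ n in atTop, ∑ᶠ i, T i w = ∑ i ∈ Finset.range n, T i w := by
  obtain ⟨n₀, hn₀⟩ := eventually_atTop.1 (h w)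
  filter_upwards [eventually_ge_atTop n₀] with n hn
  refine finsum_eq_finsetSum_of_support_subset _ fun i hi => ?_
  by_contra hi'
  refine hi (hn₀ i ?_)
  simp at hi'
  omega

/-- The sum of a locally finite sequence of linear maps. -/
def LocFin.sum {T : ℕ → M →ₗ[k] N} (h : LocFin T) : M →ₗ[k] N where
  toFun w := ∑ᶠ i, T i w
  map_add' v w := by
    obtain ⟨n, h₁, h₂, h₃⟩ := ((h.eventually_finsum v).and
      ((h.eventually_finsum w).and (h.eventually_finsum (v + w)))).exists
    rw [h₁, h₂, h₃, ← Finset.sum_add_distrib]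
    simp only [map_add]
  map_smul' c w := by
    obtain ⟨n, h₁, h₂⟩ := ((h.eventually_finsum w).and (h.eventually_finsum (c • w))).exists
    rw [h₁, h₂, RingHom.id_apply, Finset.smul_sum]
    simp only [map_smul]

theorem LocFin.sum_apply {T : ℕ → M →ₗ[k] N} (h : LocFin T) (w : M) :
    h.sum w = ∑ᶠ i, T i w := rfl

theorem LocFin.eventually_sum {T : ℕ → M →ₗ[k] N} (h : LocFin T) (w : M) :
    ∀ᶠ n in atTop, h.sum w = ∑ i ∈ Finset.range n, T i w := h.eventually_finsum w

theorem LocFin.sum_comm_of_forall {T : ℕ → M →ₗ[k] M} (h : LocFin T) (L : M →ₗ[k] M)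
    (hL : ∀ i w, T i (L w) = L (T i w)) (w : M) : h.sum (L w) = L (h.sum w) := by
  obtain ⟨n, h₁, h₂⟩ := ((h.eventually_sum w).and (h.eventually_sum (L w))).exists
  simp [h₁, h₂, hL]

theorem LocFin.apply_sum {P : Type*} [AddCommGroup P] [Module k P] {T : ℕ → M →ₗ[k] N}
    (h : LocFin T) (L : N →ₗ[k] P) (w : M) : L (h.sum w) = ∑ᶠ i, L (T i w) := by
  refine L.toAddMonoidHom.map_finsum ?_
  have := h w
  rwa [← Nat.cofinite_eq_atTop] at this

end LocallyFinite

section Model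
variable {k : Type*} [CommRing k]

variable (k) in
/-- Polynomials in the `p i` tensored with the monomials `u ^ m * v ^ n`. -/
abbrev Biv : Type _ := ℕ × ℕ →₀ MvPolynomial ℕ k

variable {M : Type*} [AddCommGroup M] [Module k M]

/-- The monomial `u ^ m * v ^ n` with coefficient `g`. -/
def mono (m n : ℕ) : MvPolynomial ℕ k →ₗ[k] Biv k := Finsupp.lsingle (m, n)

/-- The linear map on `Biv k` with prescribed values on monomials. -/
def bivLift (F : ℕ → ℕ → MvPolynomial ℕ k →ₗ[k] M) : Biv k →ₗ[k] M :=
  Finsupp.lsum k fun x => F x.1 x.2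

@[simp] theorem bivLift_mono (F : ℕ → ℕ → MvPolynomial ℕ k →ₗ[k] M) (m n : ℕ)
    (g : MvPolynomial ℕ k) : bivLift F (mono m n g) = F m n g := by
  simp [bivLift, mono]

theorem biv_induction {P : Biv k → Prop} (zero : P 0) (add : ∀ v w, P v → P w → P (v + w))
    (mono : ∀ m n g, P (mono m n g)) (w : Biv k) : P w :=
  Finsupp.induction_linear w zero add fun x g => mono x.1 x.2 g

theorem locFin_of_mono {T : ℕ → Biv k →ₗ[k] M}
    (h : ∀ m n g, ∀ᶠ i in atTop, T i (mono m n g) = 0) : LocFin T := by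
  intro w
  induction w using biv_induction with
  | zero => simp
  | add v w hv hw =>
    filter_upwards [hv, hw] with i h₁ h₂
    simp [h₁, h₂]
  | mono m n g => exact h m n g

theorem eventually_pderiv_eq_zero {σ : Type*} (a : ℕ → σ) (ha : a.Injective)
    (f : MvPolynomial σ k) : ∀ᶠ i in atTop, pderiv (a i) f = 0 := by
  classical
  have h : {i | a i ∈ f.vars}.Finite := Set.Finite.preimage ha.injOn f.vars.finite_toSet
  rw [← Nat.cofinite_eq_atTop]
  refine h.subset fun i hi => ?_
  by_contra hi'
  exact hi (pderiv_eq_zero_of_notMem_vars hi')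

theorem pderiv_comm {σ : Type*} (i j : σ) (f : MvPolynomial σ k) :
    pderiv i (pderiv j f) = pderiv j (pderiv i f) := by
  classical
  have h : ⁅pderiv i, pderiv j⁆ = (0 : Derivation k (MvPolynomial σ k) (MvPolynomial σ k)) :=
    derivation_ext fun l => by
      rw [Derivation.commutator_apply, Derivation.coe_zero, Pi.zero_apply, pderiv_X, pderiv_X,
        Pi.single_apply, Pi.single_apply]
      split_ifs <;> simp
  have := DFunLike.congr_fun h f
  rw [Derivation.commutator_apply] at this
  exact sub_eq_zero.1 this

/-- Exchange of `u` and `v`. -/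
def swapUV : Biv k →ₗ[k] Biv k := bivLift fun m n => mono n m

@[simp] theorem swapUV_mono (m n : ℕ) (g : MvPolynomial ℕ k) :
    swapUV (mono m n g) = mono n m g := by simp [swapUV]

@[simp] theorem swapUV_swapUV (w : Biv k) : swapUV (swapUV w) = w := by
  induction w using biv_induction with
  | zero => simp
  | add v w hv hw => simp [hv, hw]
  | mono m n g => simp

/-- `i u ^ i ∂/∂p_i`, with index shifted by one. -/
def gradU (i : ℕ) : Biv k →ₗ[k] Biv k :=
  bivLift fun m n => ((i + 1 : ℕ) : k) • (mono (m + i + 1) n ∘ₗ (pderiv (i + 1)).toLinearMap)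

@[simp] theorem gradU_mono (i m n : ℕ) (g : MvPolynomial ℕ k) :
    gradU i (mono m n g) = ((i + 1 : ℕ) : k) • mono (m + i + 1) n (pderiv (i + 1) g) := by
  simp [gradU]

/-- `p_j` times the truncated division by `u ^ j`, with index shifted by one. -/
def divU (j : ℕ) : Biv k →ₗ[k] Biv k :=
  bivLift fun m n => if j + 1 ≤ m then mono (m - (j + 1)) n ∘ₗ LinearMap.mulLeft k (X (j + 1)) else 0

@[simp] theorem divU_mono (j m n : ℕ) (g : MvPolynomial ℕ k) :
    divU j (mono m n g) = if j + 1 ≤ m then mono (m - (j + 1)) n (X (j + 1) * g) else 0 := by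
  simp only [divU, bivLift_mono]
  split_ifs <;> simp

/-- `u ∂/∂u`. -/
def eulerU : Biv k →ₗ[k] Biv k := bivLift fun m n => (m : k) • mono m n

@[simp] theorem eulerU_mono (m n : ℕ) (g : MvPolynomial ℕ k) :
    eulerU (mono m n g) = (m : k) • mono m n g := by simp [eulerU]

/-- The divided difference `f ↦ v (f(v, u) - f(v, v)) / (u - v)`. -/
def ddY : Biv k →ₗ[k] Biv k := bivLift fun m n => ∑ i ∈ Finset.range n, mono i (m + n - i)

theorem mono_apply (m n a b : ℕ) (g : MvPolynomial ℕ k) :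
    mono m n g (a, b) = if a = m ∧ b = n then g else 0 := by
  simp [mono, Finsupp.single_apply, eq_comm]

@[simp] theorem swapUV_apply (w : Biv k) (a b : ℕ) : swapUV w (a, b) = w (b, a) := by
  induction w using biv_induction with
  | zero => simp
  | add v w hv hw => simp [hv, hw]
  | mono m n g => simp [mono_apply, and_comm]

@[simp] theorem gradU_apply (i : ℕ) (w : Biv k) (a b : ℕ) : gradU i w (a, b) =
    if i + 1 ≤ a then ((i + 1 : ℕ) : k) • pderiv (i + 1) (w (a - (i + 1), b)) else 0 := by
  induction w using biv_induction with
  | zero => simp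
  | add v w hv hw =>
    simp only [map_add, Finsupp.add_apply, hv, hw]
    split_ifs <;> simp
  | mono m n g =>
    simp only [gradU_mono, Finsupp.smul_apply, mono_apply]
    split_ifs <;> first | omega | simp

@[simp] theorem divU_apply (j : ℕ) (w : Biv k) (a b : ℕ) :
    divU j w (a, b) = X (j + 1) * w (a + (j + 1), b) := by
  induction w using biv_induction with
  | zero => simp
  | add v w hv hw => simp [hv, hw, mul_add]
  | mono m n g =>
    simp only [divU_mono, mono_apply]
    split_ifs <;> simp only [mono_apply, Finsupp.zero_apply, mul_zero] <;> grind

@[simp] theorem eulerU_apply (w : Biv k) (a b : ℕ) : eulerU w (a, b) = (a : k) • w (a, b) := by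
  induction w using biv_induction with
  | zero => simp
  | add v w hv hw => simp [hv, hw]
  | mono m n g =>
    simp only [eulerU_mono, Finsupp.smul_apply, mono_apply]
    split_ifs with h <;> simp [h]

theorem ddY_mono_apply (m n a b : ℕ) (g : MvPolynomial ℕ k) :
    ddY (mono m n g) (a, b) = if a + b = m + n ∧ a < n then g else 0 := by
  simp only [ddY, bivLift_mono, LinearMap.sum_apply, Finsupp.finsetSum_apply, mono_apply]
  by_cases ha : a < n
  · rw [Finset.sum_eq_single_of_mem a (Finset.mem_range.2 ha)]
    · split_ifs <;> first | rfl | omega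
    · intro i _ hi
      rw [if_neg (by omega)]
  · rw [if_neg (by omega)]
    refine Finset.sum_eq_zero fun i hi => ?_
    rw [Finset.mem_range] at hi
    rw [if_neg (by omega)]

theorem ddY_apply (w : Biv k) (a b : ℕ) :
    ddY w (a, b) = ∑ i ∈ Finset.range b, w (i, a + b - i) := by
  induction w using biv_induction with
  | zero => simp
  | add v w hv hw => simp [hv, hw, Finset.sum_add_distrib]
  | mono m n g =>
    simp only [ddY_mono_apply, mono_apply]
    by_cases hm : m < b
    · rw [Finset.sum_eq_single_of_mem m (Finset.mem_range.2 hm)]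
      · split_ifs <;> first | rfl | omega
      · intro i _ hi
        rw [if_neg (by omega)]
    · rw [if_neg (by omega)]
      refine (Finset.sum_eq_zero fun i hi => ?_).symm
      rw [Finset.mem_range] at hi
      rw [if_neg (by omega)]

theorem locFin_gradU : LocFin (gradU (k := k)) := locFin_of_mono fun m n g => by
  filter_upwards [eventually_pderiv_eq_zero (fun i : ℕ => i + 1) (add_left_injective 1) g] with i hi
  simp [hi]

theorem locFin_divU : LocFin (divU (k := k)) := locFin_of_mono fun m n g => by
  filter_upwards [eventually_ge_atTop m] with i hi
  rw [divU_mono, if_neg (by omega)]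

/-- `∑ i u ^ i ∂/∂p_i`. -/
def gradSum : Biv k →ₗ[k] Biv k := locFin_gradU.sum
/-- `∑ p_j` times truncated division by `u ^ j`. -/
def divSum : Biv k →ₗ[k] Biv k := locFin_divU.sum

/-- The operator `Λ` in the variable `u`. -/
def lamU (α b : k) : Biv k →ₗ[k] Biv k := α • gradSum + divSum + b • eulerU

theorem gradU_exchange (i : ℕ) (w : Biv k) :
    swapUV (gradU i (swapUV (ddY w))) - ddY (swapUV (gradU i (swapUV w)))
      + swapUV (ddY (swapUV (gradU i w))) - gradU i (swapUV (ddY (swapUV w)))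
      = gradU i (swapUV w) - swapUV (gradU i w) := by
  induction w using biv_induction with
  | zero => simp
  | add v w hv hw =>
    simp only [map_add]
    linear_combination (norm := module) hv + hw
  | mono m n g =>
    refine Finsupp.ext fun ⟨a, b⟩ => ?_
    simp only [swapUV_mono, gradU_mono, map_smul, Finsupp.sub_apply, Finsupp.add_apply,
      Finsupp.smul_apply, swapUV_apply, gradU_apply, ddY_mono_apply, mono_apply]
    split_ifs <;> first | omega | simp

theorem divU_exchange (i : ℕ) (w : Biv k) :
    swapUV (divU i (swapUV (ddY w))) - ddY (swapUV (divU i (swapUV w)))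
      + swapUV (ddY (swapUV (divU i w))) - divU i (swapUV (ddY (swapUV w)))
      = divU i (swapUV w) - swapUV (divU i w) := by
  induction w using biv_induction with
  | zero => simp
  | add v w hv hw =>
    simp only [map_add]
    linear_combination (norm := module) hv + hw
  | mono m n g =>
    refine Finsupp.ext fun ⟨a, b⟩ => ?_
    simp only [swapUV_mono, divU_mono, apply_ite swapUV, apply_ite ddY, map_zero,
      Finsupp.sub_apply, Finsupp.add_apply, swapUV_apply, divU_apply, ddY_mono_apply]
    split_ifs <;> simp only [ddY_mono_apply, mono_apply, swapUV_apply,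
      Finsupp.zero_apply] <;> (try split_ifs) <;> first | omega | simp

theorem LocFin.exchange {T : ℕ → Biv k →ₗ[k] Biv k} (h : LocFin T)
    (hT : ∀ i w, swapUV (T i (swapUV (ddY w))) - ddY (swapUV (T i (swapUV w)))
      + swapUV (ddY (swapUV (T i w))) - T i (swapUV (ddY (swapUV w)))
      = T i (swapUV w) - swapUV (T i w)) (w : Biv k) :
    swapUV (h.sum (swapUV (ddY w))) - ddY (swapUV (h.sum (swapUV w)))
      + swapUV (ddY (swapUV (h.sum w))) - h.sum (swapUV (ddY (swapUV w)))
      = h.sum (swapUV w) - swapUV (h.sum w) := by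
  obtain ⟨N, ⟨⟨h₁, h₂⟩, h₃⟩, h₄⟩ := ((((h.eventually_sum (swapUV (ddY w))).and
    (h.eventually_sum (swapUV w))).and (h.eventually_sum w)).and
    (h.eventually_sum (swapUV (ddY (swapUV w))))).exists
  rw [h₁, h₂, h₃, h₄]
  simp only [map_sum, ← Finset.sum_sub_distrib, ← Finset.sum_add_distrib, hT]

/-- The commutator of the `∂/∂p` part in `v` with the `p` part in `u`. -/
def crossU : Biv k →ₗ[k] Biv k :=
  bivLift fun m n => ∑ j ∈ Finset.range m, ((j + 1 : ℕ) : k) • mono (m - (j + 1)) (n + j + 1)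

theorem crossU_mono_apply (m n a b : ℕ) (g : MvPolynomial ℕ k) :
    crossU (mono m n g) (a, b) = if a + b = m + n then ((m - a : ℕ) : k) • g else 0 := by
  simp only [crossU, bivLift_mono, LinearMap.sum_apply, Finsupp.finsetSum_apply,
    LinearMap.smul_apply, Finsupp.smul_apply, mono_apply]
  by_cases h : a < m
  · rw [Finset.sum_eq_single_of_mem (m - a - 1) (Finset.mem_range.2 (by omega)),
      show m - a - 1 + 1 = m - a by omega]
    · split_ifs <;> first | rfl | omega | simp
    · intro i hi hi'
      rw [Finset.mem_range] at hi
      rw [if_neg (by omega), smul_zero]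
  · rw [show m - a = 0 by omega, Finset.sum_eq_zero fun i hi => ?_]
    · simp
    · rw [Finset.mem_range] at hi
      rw [if_neg (by omega), smul_zero]

theorem gradSum_swap_divU (j : ℕ) (w : Biv k) :
    swapUV (gradSum (swapUV (divU j w))) = divU j (swapUV (gradSum (swapUV w)))
      + swapUV (gradU j (swapUV (divU j w))) - divU j (swapUV (gradU j (swapUV w))) := by
  have key : ∀ i, swapUV (gradU i (swapUV (divU j w))) = divU j (swapUV (gradU i (swapUV w))) +
      if i = j then swapUV (gradU j (swapUV (divU j w))) - divU j (swapUV (gradU j (swapUV w)))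
      else 0 := by
    intro i
    split_ifs with h
    · subst h
      abel
    · refine Finsupp.ext fun ⟨a, b⟩ => ?_
      have h' : j + 1 ≠ i + 1 := by omega
      simp only [swapUV_apply, gradU_apply, divU_apply, add_zero]
      split_ifs <;> simp [pderiv_X_of_ne h']
  obtain ⟨N, ⟨h₁, h₂⟩, h₃⟩ := (((locFin_gradU.eventually_sum (swapUV (divU j w))).and
    (locFin_gradU.eventually_sum (swapUV w))).and (eventually_gt_atTop j)).exists
  rw [gradSum, h₁, h₂, map_sum, Finset.sum_congr rfl fun i _ => key i, Finset.sum_add_distrib,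
    Finset.sum_ite_eq', if_pos (Finset.mem_range.2 h₃), map_sum, map_sum, add_sub_assoc]

theorem gradSum_swap_divSum (w : Biv k) :
    swapUV (gradSum (swapUV (divSum w))) = divSum (swapUV (gradSum (swapUV w))) + crossU w := by
  induction w using biv_induction with
  | zero => simp
  | add v w hv hw =>
    simp only [map_add]
    linear_combination (norm := module) hv + hw
  | mono m n g =>
    obtain ⟨N, ⟨h₁, h₂⟩, h₃⟩ := (((locFin_divU.eventually_sum (mono m n g)).and
      (locFin_divU.eventually_sum (swapUV (gradSum (swapUV (mono m n g)))))).and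
      (eventually_ge_atTop m)).exists
    rw [divSum, h₁, h₂]
    have key : ∀ j, swapUV (gradU j (swapUV (divU j (mono m n g))))
        - divU j (swapUV (gradU j (swapUV (mono m n g)))) =
        if j < m then ((j + 1 : ℕ) : k) • mono (m - (j + 1)) (n + j + 1) g else 0 := by
      intro j
      simp only [divU_mono, swapUV_mono, gradU_mono, map_smul]
      split_ifs <;> first | omega | simp [add_assoc]
      try module
    simp only [map_sum, gradSum_swap_divU, add_sub_assoc, key, Finset.sum_add_distrib, crossU,
      bivLift_mono, LinearMap.sum_apply, LinearMap.smul_apply]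
    congr 1
    rw [← Finset.sum_filter]
    refine Finset.sum_congr (Finset.ext fun j => ?_) fun _ _ => rfl
    simp
    omega

theorem euler_exchange (w : Biv k) :
    swapUV (eulerU (swapUV (ddY w))) - ddY (swapUV (eulerU (swapUV w)))
      + swapUV (ddY (swapUV (eulerU w))) - eulerU (swapUV (ddY (swapUV w)))
      = eulerU (swapUV w) - swapUV (eulerU w) + (crossU w - swapUV (crossU (swapUV w))) := by
  induction w using biv_induction with
  | zero => simp
  | add v w hv hw =>
    simp only [map_add]
    linear_combination (norm := module) hv + hw
  | mono m n g =>
    refine Finsupp.ext fun ⟨a, b⟩ => ?_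
    simp only [swapUV_mono, eulerU_mono, map_smul, Finsupp.sub_apply, Finsupp.add_apply,
      Finsupp.smul_apply, swapUV_apply, eulerU_apply, ddY_mono_apply, mono_apply,
      crossU_mono_apply]
    by_cases h : a + b = m + n
    · have h₀ := congrArg (Nat.cast : ℕ → k) h
      have h₁ : ((m - a : ℕ) : k) - ((n - b : ℕ) : k) = m - a := by
        obtain h' | h' := le_total a m
        · rw [show n - b = 0 by omega, Nat.cast_sub h']
          simp
        · rw [show m - a = 0 by omega, Nat.cast_sub (by omega)]
          push_cast at h₀ ⊢
          linear_combination h₀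
      have h₂ : (b : k) = m + n - a := by
        push_cast at h₀
        linear_combination h₀
      rw [if_pos h, if_pos (show b + a = n + m by omega), ← sub_smul _ _ g, h₁, h₂]
      split_ifs <;> first | omega | module | skip
      all_goals
        obtain ⟨rfl, rfl⟩ : a = n ∧ b = m := by omega
        module
    · split_ifs <;> first | omega | simp

theorem sum_range_ite_lt (a m : ℕ) (g : MvPolynomial ℕ k) :
    ∑ i ∈ Finset.range a, (if m < i then g else 0) = ((a - (m + 1) : ℕ) : k) • g := by
  induction a with
  | zero => simp
  | succ a ih =>
    rw [Finset.sum_range_succ, ih]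
    split_ifs with h
    · rw [show a + 1 - (m + 1) = a - (m + 1) + 1 by omega]
      push_cast
      module
    · rw [show a + 1 - (m + 1) = a - (m + 1) by omega, add_zero]

theorem ddY_swap_ddY_apply (m n a b : ℕ) (g : MvPolynomial ℕ k) :
    ddY (swapUV (ddY (mono m n g))) (b, a) =
      if a + b = m + n then ((a - (m + 1) : ℕ) : k) • g else 0 := by
  rw [ddY_apply, ← sum_range_ite_lt]
  simp only [swapUV_apply, ddY_mono_apply]
  split_ifs with h
  · refine Finset.sum_congr rfl fun i hi => ?_
    rw [Finset.mem_range] at hi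
    split_ifs <;> first | rfl | omega
  · refine Finset.sum_eq_zero fun i hi => ?_
    rw [Finset.mem_range] at hi
    rw [if_neg (by omega)]

theorem cross_exchange (w : Biv k) :
    crossU w - swapUV (crossU (swapUV w)) + (swapUV (ddY (swapUV (ddY w)))
      - ddY (swapUV (ddY (swapUV w)))) = ddY (swapUV w) - swapUV (ddY w) := by
  induction w using biv_induction with
  | zero => simp
  | add v w hv hw =>
    simp only [map_add]
    linear_combination (norm := module) hv + hw
  | mono m n g =>
    refine Finsupp.ext fun ⟨a, b⟩ => ?_
    simp only [swapUV_mono, Finsupp.sub_apply, Finsupp.add_apply, swapUV_apply,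
      crossU_mono_apply, ddY_mono_apply, ddY_swap_ddY_apply]
    by_cases h : a + b = m + n
    · rw [if_pos h, if_pos (show b + a = n + m by omega), if_pos h,
        if_pos (show b + a = n + m by omega)]
      obtain h' | rfl | h' := lt_trichotomy a m
      · obtain ⟨c, hc⟩ := Nat.exists_eq_add_of_lt h'
        rw [show n - b = 0 by omega, show m - a = c + 1 by omega, show a - (m + 1) = 0 by omega,
          show b - (n + 1) = c by omega]
        split_ifs <;> first | omega | skip
        push_cast
        module
      · split_ifs <;> first | omega | simp
        rw [show n - b = 0 by omega, show b - (n + 1) = 0 by omega]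
        simp
      · obtain ⟨c, hc⟩ := Nat.exists_eq_add_of_lt h'
        rw [show n - b = c + 1 by omega, show m - a = 0 by omega, show a - (m + 1) = c by omega,
          show b - (n + 1) = 0 by omega]
        split_ifs <;> first | omega | skip
        push_cast
        module
    · split_ifs <;> first | omega | simp

theorem gradSum_comm (w : Biv k) :
    swapUV (gradSum (swapUV (gradSum w))) = gradSum (swapUV (gradSum (swapUV w))) := by
  suffices h : ∀ w : Biv k,
      gradSum (swapUV (gradSum (swapUV w))) = swapUV (gradSum (swapUV (gradSum w))) from (h w).symm
  refine locFin_gradU.sum_comm_of_forall (swapUV ∘ₗ gradSum ∘ₗ swapUV) fun i w => ?_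
  have := locFin_gradU.sum_comm_of_forall (swapUV ∘ₗ gradU i ∘ₗ swapUV) (fun j w => ?_) (swapUV w)
  · simpa [gradSum] using congrArg swapUV this.symm
  · refine Finsupp.ext fun ⟨a, b⟩ => ?_
    simp only [LinearMap.comp_apply, swapUV_apply, gradU_apply]
    split_ifs <;> simp
    rw [pderiv_comm, smul_comm]

theorem divSum_comm (w : Biv k) :
    swapUV (divSum (swapUV (divSum w))) = divSum (swapUV (divSum (swapUV w))) := by
  suffices h : ∀ w : Biv k,
      divSum (swapUV (divSum (swapUV w))) = swapUV (divSum (swapUV (divSum w))) from (h w).symm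
  refine locFin_divU.sum_comm_of_forall (swapUV ∘ₗ divSum ∘ₗ swapUV) fun i w => ?_
  have := locFin_divU.sum_comm_of_forall (swapUV ∘ₗ divU i ∘ₗ swapUV) (fun j w => ?_) (swapUV w)
  · simpa [divSum] using congrArg swapUV this.symm
  · refine Finsupp.ext fun ⟨a, b⟩ => ?_
    simp only [LinearMap.comp_apply, swapUV_apply, divU_apply]
    ring

theorem gradSum_comm_euler (w : Biv k) :
    gradSum (swapUV (eulerU (swapUV w))) = swapUV (eulerU (swapUV (gradSum w))) := by
  refine locFin_gradU.sum_comm_of_forall (swapUV ∘ₗ eulerU ∘ₗ swapUV) (fun i w => ?_) w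
  refine Finsupp.ext fun ⟨a, b⟩ => ?_
  simp only [LinearMap.comp_apply, swapUV_apply, gradU_apply, eulerU_apply, Derivation.map_smul]
  split_ifs
  · module
  · simp

theorem divSum_comm_euler (w : Biv k) :
    divSum (swapUV (eulerU (swapUV w))) = swapUV (eulerU (swapUV (divSum w))) := by
  refine locFin_divU.sum_comm_of_forall (swapUV ∘ₗ eulerU ∘ₗ swapUV) (fun i w => ?_) w
  refine Finsupp.ext fun ⟨a, b⟩ => ?_
  simp

theorem eulerU_comm (w : Biv k) :
    swapUV (eulerU (swapUV (eulerU w))) = eulerU (swapUV (eulerU (swapUV w))) := by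
  refine Finsupp.ext fun ⟨a, b⟩ => ?_
  simp only [swapUV_apply, eulerU_apply]
  module

theorem lam_exchange_one (α b : k) (w : Biv k) :
    swapUV (lamU α b (swapUV (lamU α b w))) - lamU α b (swapUV (lamU α b (swapUV w)))
      + α • (swapUV (ddY (swapUV (ddY w))) - ddY (swapUV (ddY (swapUV w))))
      = α • (ddY (swapUV w) - swapUV (ddY w)) := by
  have h₁ := gradSum_comm w
  have h₂ := divSum_comm w
  have h₃ := eulerU_comm w
  have h₄ := gradSum_comm_euler w
  have h₅ := congrArg swapUV (gradSum_comm_euler (swapUV w))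
  have h₆ := divSum_comm_euler w
  have h₇ := congrArg swapUV (divSum_comm_euler (swapUV w))
  have h₈ := gradSum_swap_divSum w
  have h₉ := congrArg swapUV (gradSum_swap_divSum (swapUV w))
  have h₀ := cross_exchange w
  simp only [lamU, LinearMap.add_apply, LinearMap.smul_apply, map_add, map_smul,
    swapUV_swapUV] at *
  linear_combination (norm := module) (α * α) • h₁ + h₂ + (b * b) • h₃ - (α * b) • h₄
    + (α * b) • h₅ - b • h₆ + b • h₇ + α • h₈ - α • h₉ + α • h₀

theorem lam_exchange_two (α b : k) (w : Biv k) :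
    swapUV (lamU α b (swapUV (ddY w))) - ddY (swapUV (lamU α b (swapUV w)))
      + swapUV (ddY (swapUV (lamU α b w))) - lamU α b (swapUV (ddY (swapUV w)))
      + b • (swapUV (ddY (swapUV (ddY w))) - ddY (swapUV (ddY (swapUV w))))
      = lamU α b (swapUV w) - swapUV (lamU α b w) + b • (ddY (swapUV w) - swapUV (ddY w)) := by
  have h₁ := locFin_gradU.exchange gradU_exchange w
  have h₂ := locFin_divU.exchange divU_exchange w
  have h₃ := euler_exchange w
  have h₄ := cross_exchange w
  simp only [lamU, gradSum, divSum, LinearMap.add_apply, LinearMap.smul_apply, map_add, map_smul]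
  linear_combination (norm := module) α • h₁ + h₂ + b • h₃ + b • h₄

theorem divSum_mono (m n : ℕ) (g : MvPolynomial ℕ k) : divSum (mono m n g) =
    ∑ j ∈ Finset.range m, mono (m - (j + 1)) n (X (j + 1) * g) := by
  obtain ⟨N, h₁, h₂⟩ := ((locFin_divU.eventually_sum (mono m n g)).and
    (eventually_ge_atTop m)).exists
  rw [divSum, h₁]
  simp only [divU_mono]
  rw [← Finset.sum_filter]
  refine Finset.sum_congr (Finset.ext fun j => ?_) fun _ _ => rfl
  simp
  omega

/-- Two operators acting on both halves of the alphabet through `lamU`, `ddY` and the `2 × 2`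
matrix with characteristic polynomial `t ^ 2 - b t - α` satisfy the exchange relation. -/
theorem exchange_of_intertwine (α b : k) (A C D : M →ₗ[k] M) (J J' : Biv k →ₗ[k] M)
    (hA : ∀ w, A (J w) = J (lamU α b w) + J' (ddY w))
    (hA' : ∀ w, A (J' w) = J' (lamU α b w) + (α • J (ddY w) + b • J' (ddY w)))
    (hC : ∀ w, C (J w) = J (swapUV (lamU α b (swapUV w))) + J' (swapUV (ddY (swapUV w))))
    (hC' : ∀ w, C (J' w) = J' (swapUV (lamU α b (swapUV w)))
      + (α • J (swapUV (ddY (swapUV w))) + b • J' (swapUV (ddY (swapUV w)))))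
    (hD : ∀ w, D (J w) = J' (swapUV w))
    (hD' : ∀ w, D (J' w) = α • J (swapUV w) + b • J' (swapUV w)) (w : Biv k) :
    C (A (J w)) + D (A (J w)) = A (C (J w) + D (J w)) ∧
      A (C (J w) + D (J w)) = A (C (J w)) + D (C (J w)) ∧
      A (C (J w)) + D (C (J w)) = C (A (J w) + D (J w)) := by
  have h₁ := congrArg J (lam_exchange_one α b w)
  have h₂ := congrArg J' (lam_exchange_two α b w)
  simp only [map_add, map_sub, map_smul] at h₁ h₂
  simp only [hA, hA', hC, hC', hD, hD', map_add, swapUV_swapUV]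
  refine ⟨?_, ?_, ?_⟩
  · linear_combination (norm := module) h₁ + h₂
  · trivial
  · linear_combination (norm := module) -h₁ - h₂

end Model

section Transfer

theorem locFin_of_pderiv {v : ℕ → Var} (hv : v.Injective) {T : ℕ → R →ₗ[K] R}
    (h : ∀ i f, (∀ j, i ≤ j → pderiv (v j) f = 0) → T i f = 0) : LocFin T := fun f => by
  filter_upwards [eventually_forall_ge_atTop.2 (eventually_pderiv_eq_zero v hv f)] with i hi
  exact h i f hi

theorem LocFin.sum_eq_zero {T : ℕ → R →ₗ[K] R} (h : LocFin T) {f : R} (hf : ∀ i, T i f = 0) :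
    h.sum f = 0 := by
  simp [h.sum_apply, hf]

/-- Multiplication by `h` after the derivatives along `v` and `w`. -/
def mulPderivTwo (h : R) (v w : Var) : R →ₗ[K] R :=
  LinearMap.mulLeft K h ∘ₗ (pderiv v).toLinearMap ∘ₗ (pderiv w).toLinearMap

theorem mulPderivTwo_apply (h : R) (v w : Var) (f : R) :
    mulPderivTwo h v w f = h * pderiv v (pderiv w f) := rfl

theorem mulPderivTwo_eq_zero (h : R) (v w : Var) {f : R} (hf : pderiv v f = 0) :
    mulPderivTwo h v w f = 0 := by
  rw [mulPderivTwo_apply, pderiv_comm, hf, map_zero, mul_zero]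

theorem mulPderivTwo_eq_zero' (h : R) (v w : Var) {f : R} (hf : pderiv w f = 0) :
    mulPderivTwo h v w f = 0 := by
  rw [mulPderivTwo_apply, hf, map_zero, mul_zero]

variable {a c : ℕ → Var}

theorem injective_p_succ : (fun i : ℕ => Var.p (i + 1)).Injective := fun i j h => by
  simpa using h

/-- The `α`-term of `Lam`, for fixed indices. -/
def lamAlphaTerm (a : ℕ → Var) (i j : ℕ) : R →ₗ[K] R :=
  ((i + 1 : ℕ) : K) • mulPderivTwo (X (a (i + j + 1))) (Var.p (i + 1)) (a j)

theorem locFin_lamAlphaTerm (ha : a.Injective) (i : ℕ) : LocFin (lamAlphaTerm a i) :=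
  locFin_of_pderiv ha fun j f hf => by
    rw [lamAlphaTerm, LinearMap.smul_apply, mulPderivTwo_eq_zero' _ _ _ (hf j le_rfl), smul_zero]

theorem locFin_sum_lamAlphaTerm (ha : a.Injective) :
    LocFin fun i => (locFin_lamAlphaTerm ha i).sum :=
  locFin_of_pderiv injective_p_succ fun i f hf => LocFin.sum_eq_zero _ fun j => by
    rw [lamAlphaTerm, LinearMap.smul_apply, mulPderivTwo_eq_zero _ _ _ (hf i le_rfl), smul_zero]

/-- The `p`-term of `Lam`, for fixed indices. -/
def lamMulTerm (a : ℕ → Var) (i j : ℕ) : R →ₗ[K] R :=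
  LinearMap.mulLeft K (X (a i) * X (Var.p (j + 1))) ∘ₗ (pderiv (a (i + j + 1))).toLinearMap

theorem lamMulTerm_eq_zero (i j : ℕ) {f : R} (hf : pderiv (a (i + j + 1)) f = 0) :
    lamMulTerm a i j f = 0 := by
  simp [lamMulTerm, hf]

theorem locFin_lamMulTerm (ha : a.Injective) (i : ℕ) : LocFin (lamMulTerm a i) :=
  locFin_of_pderiv ha fun j f hf => lamMulTerm_eq_zero i j (hf _ (by omega))

theorem locFin_sum_lamMulTerm (ha : a.Injective) :
    LocFin fun i => (locFin_lamMulTerm ha i).sum :=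
  locFin_of_pderiv ha fun i f hf => LocFin.sum_eq_zero _ fun j =>
    lamMulTerm_eq_zero i j (hf _ (by omega))

/-- The `b`-term of `Lam`, for a fixed index. -/
def lamEulerTerm (a : ℕ → Var) (i : ℕ) : R →ₗ[K] R :=
  ((i + 1 : ℕ) : K) • (LinearMap.mulLeft K (X (a (i + 1))) ∘ₗ (pderiv (a (i + 1))).toLinearMap)

theorem locFin_lamEulerTerm (ha : a.Injective) : LocFin (lamEulerTerm a) :=
  locFin_of_pderiv ha fun i f hf => by
    simp [lamEulerTerm, hf (i + 1) (by omega)]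

/-- `Lam` as a linear map. -/
def lamLin (ha : a.Injective) : R →ₗ[K] R :=
  alpha • (locFin_sum_lamAlphaTerm ha).sum + (locFin_sum_lamMulTerm ha).sum
    + bb • (locFin_lamEulerTerm ha).sum

/-- The common shape of the three sums in `MY` and `MZ`, for fixed indices. -/
def exchTerm (s t u v : ℕ → Var) (i j l : ℕ) : R →ₗ[K] R :=
  mulPderivTwo (X (s (i + j + 1)) * X (t l)) (u (i + l + 1)) (v j)

variable {s t u v : ℕ → Var}

theorem locFin_exchTerm (hu : u.Injective) (i j : ℕ) : LocFin (exchTerm s t u v i j) :=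
  locFin_of_pderiv hu fun _ _ hf => mulPderivTwo_eq_zero _ _ _ (hf _ (by omega))

theorem locFin_sum_exchTerm (hu : u.Injective) (hv : v.Injective) (i : ℕ) :
    LocFin fun j => (locFin_exchTerm (s := s) (t := t) (v := v) hu i j).sum :=
  locFin_of_pderiv hv fun _ _ hf => LocFin.sum_eq_zero _ fun _ =>
    mulPderivTwo_eq_zero' _ _ _ (hf _ le_rfl)

theorem locFin_sum_sum_exchTerm (hu : u.Injective) (hv : v.Injective) :
    LocFin fun i => (locFin_sum_exchTerm (s := s) (t := t) hu hv i).sum :=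
  locFin_of_pderiv hu fun _ _ hf => LocFin.sum_eq_zero _ fun _ => LocFin.sum_eq_zero _ fun _ =>
    mulPderivTwo_eq_zero _ _ _ (hf _ (by omega))

variable (s t) in
/-- The common shape of the three sums in `MY` and `MZ`. -/
def exchLin (hu : u.Injective) (hv : v.Injective) : R →ₗ[K] R :=
  (locFin_sum_sum_exchTerm (s := s) (t := t) hu hv).sum

/-- The common shape of the three sums in `Delta`, for fixed indices. -/
def replTerm (s t u v : ℕ → Var) (i j : ℕ) : R →ₗ[K] R :=
  mulPderivTwo (X (s i) * X (t j)) (u i) (v j)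

theorem locFin_replTerm (hv : v.Injective) (i : ℕ) : LocFin (replTerm s t u v i) :=
  locFin_of_pderiv hv fun _ _ hf => mulPderivTwo_eq_zero' _ _ _ (hf _ le_rfl)

theorem locFin_sum_replTerm (hu : u.Injective) (hv : v.Injective) :
    LocFin fun i => (locFin_replTerm (s := s) (t := t) (u := u) hv i).sum :=
  locFin_of_pderiv hu fun _ _ hf => LocFin.sum_eq_zero _ fun _ =>
    mulPderivTwo_eq_zero _ _ _ (hf _ le_rfl)

variable (s t) in
/-- The common shape of the three sums in `Delta`. -/
def replLin (hu : u.Injective) (hv : v.Injective) : R →ₗ[K] R :=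
  (locFin_sum_replTerm (s := s) (t := t) hu hv).sum

theorem exchLin_eq_zero (hu : u.Injective) (hv : v.Injective) {f : R}
    (hf : (∀ i, pderiv (u i) f = 0) ∨ ∀ i, pderiv (v i) f = 0) : exchLin s t hu hv f = 0 :=
  LocFin.sum_eq_zero _ fun _ => LocFin.sum_eq_zero _ fun _ => LocFin.sum_eq_zero _ fun _ =>
    hf.elim (fun h => mulPderivTwo_eq_zero _ _ _ (h _)) fun h => mulPderivTwo_eq_zero' _ _ _ (h _)

theorem replLin_eq_zero (hu : u.Injective) (hv : v.Injective) {f : R}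
    (hf : (∀ i, pderiv (u i) f = 0) ∨ ∀ i, pderiv (v i) f = 0) : replLin s t hu hv f = 0 :=
  LocFin.sum_eq_zero _ fun _ => LocFin.sum_eq_zero _ fun _ =>
    hf.elim (fun h => mulPderivTwo_eq_zero _ _ _ (h _)) fun h => mulPderivTwo_eq_zero' _ _ _ (h _)

theorem lamLin_eq_zero (ha : a.Injective) {f : R} (hf : ∀ i, pderiv (a i) f = 0) :
    lamLin ha f = 0 := by
  have h₁ : (locFin_sum_lamAlphaTerm ha).sum f = 0 :=
    LocFin.sum_eq_zero _ fun i => LocFin.sum_eq_zero _ fun j => by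
      rw [lamAlphaTerm, LinearMap.smul_apply, mulPderivTwo_eq_zero' _ _ _ (hf j), smul_zero]
  have h₂ : (locFin_sum_lamMulTerm ha).sum f = 0 :=
    LocFin.sum_eq_zero _ fun i => LocFin.sum_eq_zero _ fun j => lamMulTerm_eq_zero i j (hf _)
  have h₃ : (locFin_lamEulerTerm ha).sum f = 0 :=
    LocFin.sum_eq_zero _ fun i => by simp [lamEulerTerm, hf]
  simp [lamLin, h₁, h₂, h₃]

theorem pderiv_locFin_sum_eq_zero {T : ℕ → R →ₗ[K] R} (h : LocFin T) (x : Var) {f : R}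
    (hf : ∀ i, pderiv x (T i f) = 0) : pderiv x (h.sum f) = 0 := by
  have := h.apply_sum (pderiv x).toLinearMap f
  simpa [hf] using this

theorem pderiv_lamLin_eq_zero (ha : a.Injective) {x : Var} (hx : ∀ i, a i ≠ x)
    (hp : ∀ i, Var.p i ≠ x) {f : R} (hf : pderiv x f = 0) : pderiv x (lamLin ha f) = 0 := by
  have h₁ : pderiv x ((locFin_sum_lamAlphaTerm ha).sum f) = 0 :=
    pderiv_locFin_sum_eq_zero _ _ fun i => pderiv_locFin_sum_eq_zero _ _ fun j => by
      simp [lamAlphaTerm, mulPderivTwo_apply, pderiv_X_of_ne (hx _), pderiv_comm x, hf]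
  have h₂ : pderiv x ((locFin_sum_lamMulTerm ha).sum f) = 0 :=
    pderiv_locFin_sum_eq_zero _ _ fun i => pderiv_locFin_sum_eq_zero _ _ fun j => by
      simp [lamMulTerm, pderiv_X_of_ne (hx _), pderiv_X_of_ne (hp _), pderiv_comm x, hf]
  have h₃ : pderiv x ((locFin_lamEulerTerm ha).sum f) = 0 :=
    pderiv_locFin_sum_eq_zero _ _ fun i => by
      simp [lamEulerTerm, pderiv_X_of_ne (hx _), pderiv_comm x, hf]
  simp [lamLin, h₁, h₂, h₃]

/-- The embedding of `Biv K` sending `u ^ m * v ^ n` to `a_m c_n`. -/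
def emb (a c : ℕ → Var) : Biv K →ₗ[K] R :=
  bivLift fun m n => LinearMap.mulLeft K (X (a m) * X (c n)) ∘ₗ (rename Var.p).toLinearMap

theorem emb_mono (a c : ℕ → Var) (m n : ℕ) (g : MvPolynomial ℕ K) :
    emb a c (mono m n g) = X (a m) * X (c n) * rename Var.p g := by
  simp [emb, mul_assoc]

theorem emb_swapUV (a c : ℕ → Var) (w : Biv K) : emb a c (swapUV w) = emb c a w := by
  induction w using biv_induction with
  | zero => simp
  | add v w hv hw => simp [hv, hw]
  | mono m n g => simp [emb_mono, mul_comm (X (a n))]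

theorem pderiv_rename_p_eq_zero {x : Var} (hx : ∀ i, Var.p i ≠ x) (g : MvPolynomial ℕ K) :
    pderiv x (rename Var.p g) = 0 := by
  classical
  refine pderiv_eq_zero_of_notMem_vars fun h => ?_
  obtain ⟨i, -, hi⟩ := Finset.mem_image.1 (vars_rename _ _ h)
  exact hx i hi

theorem pderiv_rename_p (i : ℕ) (g : MvPolynomial ℕ K) :
    pderiv (Var.p i) (rename Var.p g) = rename Var.p (pderiv i g) :=
  pderiv_rename (fun _ _ h => Var.p.inj h) i g

theorem pderiv_X_mul_of_pderiv_eq_zero (ha : a.Injective) {i m : ℕ} {h : R}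
    (hh : pderiv (a i) h = 0) : pderiv (a i) (X (a m) * h) = if i = m then h else 0 := by
  split_ifs with him
  · subst him
    simp [hh]
  · simp [hh, pderiv_X_of_ne (ha.ne (Ne.symm him))]

theorem finsum_finsum_eq_sum_range {M : Type*} [AddCommMonoid M] (F : ℕ → ℕ → M) (m : ℕ)
    (hF : ∀ i j, i + j + 1 ≠ m → F i j = 0) :
    ∑ᶠ (i : ℕ) (j : ℕ), F i j = ∑ j ∈ Finset.range m, F (m - (j + 1)) j := by
  have h : ∀ i, ∑ᶠ j, F i j = F i (m - 1 - i) := fun i =>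
    finsum_eq_single _ _ fun j hj => hF _ _ (by omega)
  rw [finsum_congr h, finsum_eq_finsetSum_of_support_subset _ (s := Finset.range m),
    ← Finset.sum_range_reflect]
  · refine Finset.sum_congr rfl fun j hj => ?_
    rw [Finset.mem_range] at hj
    congr 1 <;> omega
  · intro i hi
    by_contra hi'
    simp only [Finset.coe_range, Set.mem_Iio] at hi'
    exact hi (hF _ _ (by omega))

theorem lamLin_emb (ha : a.Injective) (hac : ∀ i j, c i ≠ a j) (hap : ∀ i j, Var.p i ≠ a j)
    (hcp : ∀ i j, c i ≠ Var.p j) (w : Biv K) :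
    lamLin ha (emb a c w) = emb a c (lamU alpha bb w) := by
  induction w using biv_induction with
  | zero => simp
  | add v w hv hw => simp only [map_add, hv, hw]
  | mono m n g =>
    have hd : ∀ i, pderiv (a i) (emb a c (mono m n g)) =
        if i = m then X (c n) * rename Var.p g else 0 := fun i => by
      rw [emb_mono, mul_assoc, pderiv_X_mul_of_pderiv_eq_zero ha]
      simp [pderiv_X_of_ne (hac _ _), pderiv_rename_p_eq_zero (hap · i)]
    have h₁ : (locFin_sum_lamAlphaTerm ha).sum (emb a c (mono m n g)) =
        emb a c (gradSum (mono m n g)) := by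
      rw [gradSum, LocFin.apply_sum, LocFin.sum_apply]
      refine finsum_congr fun i => ?_
      rw [LocFin.sum_apply, finsum_eq_single _ m]
      · simp only [lamAlphaTerm, mulPderivTwo_apply, LinearMap.smul_apply, hd, if_true]
        simp [emb_mono, pderiv_X_of_ne (hcp _ _), pderiv_rename_p, mul_assoc, add_comm i m]
      · intro j hj
        simp [lamAlphaTerm, mulPderivTwo_apply, hd, hj]
    have h₂ : (locFin_sum_lamMulTerm ha).sum (emb a c (mono m n g)) =
        emb a c (divSum (mono m n g)) := by
      rw [divSum_mono, map_sum, LocFin.sum_apply]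
      simp only [LocFin.sum_apply]
      rw [finsum_finsum_eq_sum_range _ m]
      · refine Finset.sum_congr rfl fun j hj => ?_
        rw [Finset.mem_range] at hj
        simp only [lamMulTerm, LinearMap.comp_apply, Derivation.coeFn_coe, hd]
        rw [if_pos (by omega)]
        simp only [emb_mono, LinearMap.mulLeft_apply, map_mul, rename_X]
        ring
      · intro i j hij
        exact lamMulTerm_eq_zero i j (by rw [hd, if_neg hij])
    have h₃ : (locFin_lamEulerTerm ha).sum (emb a c (mono m n g)) =
        emb a c (eulerU (mono m n g)) := by
      rw [LocFin.sum_apply]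
      cases m with
      | zero =>
        rw [finsum_congr (g := fun _ => 0) fun i => by simp [lamEulerTerm, hd]]
        simp
      | succ m =>
        rw [finsum_eq_single _ m]
        · simp [lamEulerTerm, hd]
          simp [emb_mono, mul_assoc]
        · intro i hi
          simp [lamEulerTerm, hd, hi]
    simp only [lamLin, lamU, LinearMap.add_apply, LinearMap.smul_apply, map_add, map_smul,
      h₁, h₂, h₃]

theorem exchLin_emb (hu : u.Injective) (hv : v.Injective) (hvu : ∀ i j, v i ≠ u j)
    (hup : ∀ i j, Var.p i ≠ u j) (hvp : ∀ i j, Var.p i ≠ v j) (w : Biv K) :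
    exchLin s t hu hv (emb v u w) = emb t s (ddY w) := by
  induction w using biv_induction with
  | zero => simp
  | add v w hv hw => simp only [map_add, hv, hw]
  | mono m n g =>
    have hd : ∀ i j, pderiv (u i) (pderiv (v j) (emb v u (mono m n g))) =
        if j = m ∧ i = n then rename Var.p g else 0 := fun i j => by
      rw [emb_mono, mul_assoc, pderiv_X_mul_of_pderiv_eq_zero hv, apply_ite (pderiv (u i)),
        pderiv_X_mul_of_pderiv_eq_zero hu (pderiv_rename_p_eq_zero (hup · i) g), map_zero, ite_and]
      simp [pderiv_X_of_ne (hvu _ _).symm, pderiv_rename_p_eq_zero (hvp · j)]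
    have h : ∀ i, (locFin_sum_exchTerm (s := s) (t := t) hu hv i).sum (emb v u (mono m n g)) =
        ∑ᶠ l, exchTerm s t u v i m l (emb v u (mono m n g)) := fun i => by
      rw [LocFin.sum_apply, finsum_eq_single _ m]
      · rfl
      · intro j hj
        refine LocFin.sum_eq_zero _ fun l => ?_
        simp [exchTerm, mulPderivTwo_apply, hd, hj]
    rw [exchLin, LocFin.sum_apply, finsum_congr h, finsum_finsum_eq_sum_range _ n]
    · simp only [ddY, bivLift_mono, LinearMap.sum_apply, map_sum]
      refine Finset.sum_congr rfl fun l hl => ?_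
      rw [Finset.mem_range] at hl
      rw [exchTerm, mulPderivTwo_apply, hd, if_pos ⟨rfl, by omega⟩, emb_mono,
        show n - (l + 1) + m + 1 = m + n - l by omega]
      ring
    · intro i l hil
      simp [exchTerm, mulPderivTwo_apply, hd, hil]

theorem replLin_emb (hu : u.Injective) (hv : v.Injective) (huv : ∀ i j, u i ≠ v j)
    (hup : ∀ i j, Var.p i ≠ u j) (hvp : ∀ i j, Var.p i ≠ v j) (w : Biv K) :
    replLin s t hu hv (emb u v w) = emb s t w := by
  induction w using biv_induction with
  | zero => simp
  | add v w hv hw => simp only [map_add, hv, hw]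
  | mono m n g =>
    have hd : ∀ i j, pderiv (u i) (pderiv (v j) (emb u v (mono m n g))) =
        if i = m ∧ j = n then rename Var.p g else 0 := fun i j => by
      rw [pderiv_comm, emb_mono, mul_assoc, pderiv_X_mul_of_pderiv_eq_zero hu,
        apply_ite (pderiv (v j)),
        pderiv_X_mul_of_pderiv_eq_zero hv (pderiv_rename_p_eq_zero (hvp · j) g), map_zero, ite_and]
      simp [pderiv_X_of_ne (huv _ _).symm, pderiv_rename_p_eq_zero (hup · i)]
    rw [replLin, LocFin.sum_apply, finsum_eq_single _ m, LocFin.sum_apply, finsum_eq_single _ n]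
    · rw [replTerm, mulPderivTwo_apply, hd, if_pos ⟨rfl, rfl⟩, emb_mono]
    · intro j hj
      simp [replTerm, mulPderivTwo_apply, hd, hj]
    · intro i hi
      refine LocFin.sum_eq_zero _ fun l => ?_
      simp [replTerm, mulPderivTwo_apply, hd, hi]

theorem injective_y : Var.y.Injective := fun _ _ h => Var.y.inj h
theorem injective_y' : Var.y'.Injective := fun _ _ h => Var.y'.inj h
theorem injective_z : Var.z.Injective := fun _ _ h => Var.z.inj h
theorem injective_z' : Var.z'.Injective := fun _ _ h => Var.z'.inj h

/-- `MY` as a linear map. -/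
def myLin : R →ₗ[K] R :=
  alpha • exchLin Var.z' Var.y' injective_z injective_y
    + exchLin Var.z Var.y injective_z' injective_y'
    + bb • exchLin Var.z' Var.y' injective_z' injective_y'

/-- `MZ` as a linear map. -/
def mzLin : R →ₗ[K] R :=
  alpha • exchLin Var.y' Var.z' injective_y injective_z
    + exchLin Var.y Var.z injective_y' injective_z'
    + bb • exchLin Var.y' Var.z' injective_y' injective_z'

/-- `LamYt` as a linear map. -/
def lamYtLin : R →ₗ[K] R := lamLin injective_y + lamLin injective_y' + myLin

/-- `LamZt` as a linear map. -/
def lamZtLin : R →ₗ[K] R := lamLin injective_z + lamLin injective_z' + mzLin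

/-- `Delta` as a linear map. -/
def deltaLin : R →ₗ[K] R :=
  alpha • replLin Var.z' Var.y' injective_y injective_z
    + replLin Var.z Var.y injective_y' injective_z'
    + bb • replLin Var.z' Var.y' injective_y' injective_z'

theorem pderiv_emb_eq_zero {x : Var} (ha : ∀ i, a i ≠ x) (hc : ∀ i, c i ≠ x)
    (hp : ∀ i, Var.p i ≠ x) (w : Biv K) : pderiv x (emb a c w) = 0 := by
  induction w using biv_induction with
  | zero => simp
  | add v w hv hw => simp [hv, hw]
  | mono m n g =>
    simp [emb_mono, pderiv_X_of_ne (ha _), pderiv_X_of_ne (hc _), pderiv_rename_p_eq_zero hp]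

theorem lamYtLin_emb (w : Biv K) : lamYtLin (emb Var.y Var.z w) =
    emb Var.y Var.z (lamU alpha bb w) + alpha • emb Var.y' Var.z' (ddY w) := by
  have h' : ∀ i, pderiv (Var.y' i) (emb Var.y Var.z w) = 0 := fun i =>
    pderiv_emb_eq_zero (by simp) (by simp) (by simp) w
  rw [lamYtLin, myLin]
  simp only [LinearMap.add_apply, LinearMap.smul_apply]
  rw [lamLin_emb injective_y (by simp) (by simp) (by simp), lamLin_eq_zero injective_y' h',
    exchLin_emb injective_z injective_y (by simp) (by simp) (by simp),
    exchLin_eq_zero injective_z' injective_y' (.inr h'),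
    exchLin_eq_zero injective_z' injective_y' (.inr h')]
  simp

theorem lamYtLin_emb' (w : Biv K) : lamYtLin (emb Var.y' Var.z' w) =
    emb Var.y' Var.z' (lamU alpha bb w)
      + (emb Var.y Var.z (ddY w) + bb • emb Var.y' Var.z' (ddY w)) := by
  have h' : ∀ i, pderiv (Var.y i) (emb Var.y' Var.z' w) = 0 := fun i =>
    pderiv_emb_eq_zero (by simp) (by simp) (by simp) w
  rw [lamYtLin, myLin]
  simp only [LinearMap.add_apply, LinearMap.smul_apply]
  rw [lamLin_emb injective_y' (by simp) (by simp) (by simp), lamLin_eq_zero injective_y h',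
    exchLin_emb injective_z' injective_y' (by simp) (by simp) (by simp),
    exchLin_emb injective_z' injective_y' (by simp) (by simp) (by simp),
    exchLin_eq_zero injective_z injective_y (.inr h')]
  simp

theorem lamZtLin_emb (w : Biv K) : lamZtLin (emb Var.y Var.z w) =
    emb Var.y Var.z (swapUV (lamU alpha bb (swapUV w)))
      + alpha • emb Var.y' Var.z' (swapUV (ddY (swapUV w))) := by
  rw [emb_swapUV, emb_swapUV, ← emb_swapUV Var.z Var.y w]
  have h' : ∀ i, pderiv (Var.z' i) (emb Var.z Var.y (swapUV w)) = 0 := fun i =>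
    pderiv_emb_eq_zero (by simp) (by simp) (by simp) _
  rw [lamZtLin, mzLin]
  simp only [LinearMap.add_apply, LinearMap.smul_apply]
  rw [lamLin_emb injective_z (by simp) (by simp) (by simp), lamLin_eq_zero injective_z' h',
    exchLin_emb injective_y injective_z (by simp) (by simp) (by simp),
    exchLin_eq_zero injective_y' injective_z' (.inr h'),
    exchLin_eq_zero injective_y' injective_z' (.inr h')]
  simp

theorem lamZtLin_emb' (w : Biv K) : lamZtLin (emb Var.y' Var.z' w) =
    emb Var.y' Var.z' (swapUV (lamU alpha bb (swapUV w)))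
      + (emb Var.y Var.z (swapUV (ddY (swapUV w)))
        + bb • emb Var.y' Var.z' (swapUV (ddY (swapUV w)))) := by
  rw [emb_swapUV, emb_swapUV, emb_swapUV, ← emb_swapUV Var.z' Var.y' w]
  have h' : ∀ i, pderiv (Var.z i) (emb Var.z' Var.y' (swapUV w)) = 0 := fun i =>
    pderiv_emb_eq_zero (by simp) (by simp) (by simp) _
  rw [lamZtLin, mzLin]
  simp only [LinearMap.add_apply, LinearMap.smul_apply]
  rw [lamLin_emb injective_z' (by simp) (by simp) (by simp), lamLin_eq_zero injective_z h',
    exchLin_emb injective_y' injective_z' (by simp) (by simp) (by simp),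
    exchLin_emb injective_y' injective_z' (by simp) (by simp) (by simp),
    exchLin_eq_zero injective_y injective_z (.inr h')]
  simp

theorem deltaLin_emb (w : Biv K) : deltaLin (emb Var.y Var.z w) =
    alpha • emb Var.y' Var.z' (swapUV w) := by
  have h' : ∀ i, pderiv (Var.y' i) (emb Var.y Var.z w) = 0 := fun i =>
    pderiv_emb_eq_zero (by simp) (by simp) (by simp) _
  rw [emb_swapUV, deltaLin]
  simp only [LinearMap.add_apply, LinearMap.smul_apply]
  rw [replLin_emb injective_y injective_z (by simp) (by simp) (by simp),
    replLin_eq_zero injective_y' injective_z' (.inl h'),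
    replLin_eq_zero injective_y' injective_z' (.inl h')]
  simp

theorem deltaLin_emb' (w : Biv K) : deltaLin (emb Var.y' Var.z' w) =
    emb Var.y Var.z (swapUV w) + bb • emb Var.y' Var.z' (swapUV w) := by
  have h' : ∀ i, pderiv (Var.y i) (emb Var.y' Var.z' w) = 0 := fun i =>
    pderiv_emb_eq_zero (by simp) (by simp) (by simp) _
  rw [emb_swapUV, emb_swapUV, deltaLin]
  simp only [LinearMap.add_apply, LinearMap.smul_apply]
  rw [replLin_emb injective_y' injective_z' (by simp) (by simp) (by simp),
    replLin_emb injective_y' injective_z' (by simp) (by simp) (by simp),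
    replLin_eq_zero injective_y injective_z (.inl h')]
  simp

/-- The statement of the exchange identity for a single element. -/
def Exchanges (f : R) : Prop :=
  lamZtLin (lamYtLin f) + deltaLin (lamYtLin f) = lamYtLin (lamZtLin f + deltaLin f) ∧
    lamYtLin (lamZtLin f + deltaLin f) = lamYtLin (lamZtLin f) + deltaLin (lamZtLin f) ∧
    lamYtLin (lamZtLin f) + deltaLin (lamZtLin f) = lamZtLin (lamYtLin f + deltaLin f)

theorem exchanges_emb (w : Biv K) : Exchanges (emb Var.y Var.z w) := by
  refine exchange_of_intertwine alpha bb lamYtLin lamZtLin deltaLin (emb Var.y Var.z)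
    (alpha • emb Var.y' Var.z') lamYtLin_emb ?_ lamZtLin_emb ?_ deltaLin_emb ?_ w
  · intro w
    simp only [LinearMap.smul_apply, map_smul, lamYtLin_emb', smul_add, smul_comm alpha bb]
  · intro w
    simp only [LinearMap.smul_apply, map_smul, lamZtLin_emb', smul_add, smul_comm alpha bb]
  · intro w
    simp only [LinearMap.smul_apply, map_smul, deltaLin_emb', smul_add, smul_comm alpha bb]

theorem exchanges_emb' (w : Biv K) : Exchanges (emb Var.y' Var.z' w) := by
  refine exchange_of_intertwine alpha bb lamYtLin lamZtLin deltaLin (emb Var.y' Var.z')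
    (emb Var.y Var.z + bb • emb Var.y' Var.z') lamYtLin_emb' ?_ lamZtLin_emb' ?_ deltaLin_emb' ?_ w
  · intro w
    simp only [LinearMap.add_apply, LinearMap.smul_apply, map_add, map_smul, lamYtLin_emb',
      lamYtLin_emb]
    simp only [smul_add]
    abel
  · intro w
    simp only [LinearMap.add_apply, LinearMap.smul_apply, map_add, map_smul, lamZtLin_emb',
      lamZtLin_emb]
    simp only [smul_add]
    abel
  · intro w
    simp only [LinearMap.add_apply, LinearMap.smul_apply, map_add, map_smul, deltaLin_emb',
      deltaLin_emb]

theorem exchanges_of_pderiv_z {f : R} (hz : ∀ i, pderiv (Var.z i) f = 0)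
    (hz' : ∀ i, pderiv (Var.z' i) f = 0) : Exchanges f := by
  have vanish : ∀ {f : R}, (∀ i, pderiv (Var.z i) f = 0) → (∀ i, pderiv (Var.z' i) f = 0) →
      lamZtLin f = 0 ∧ deltaLin f = 0 ∧ myLin f = 0 := fun hz hz' => by
    refine ⟨?_, ?_, ?_⟩
    · simp [lamZtLin, mzLin, lamLin_eq_zero, exchLin_eq_zero, hz, hz']
    · simp [deltaLin, replLin_eq_zero, hz, hz']
    · simp [myLin, exchLin_eq_zero, hz, hz']
  obtain ⟨h₁, h₂, h₃⟩ := vanish hz hz'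
  have hL : lamYtLin f = lamLin injective_y f + lamLin injective_y' f := by
    simp [lamYtLin, h₃]
  obtain ⟨h₄, h₅, -⟩ := vanish (f := lamYtLin f)
    (fun i => by simp [hL, pderiv_lamLin_eq_zero, hz]) fun i => by
      simp [hL, pderiv_lamLin_eq_zero, hz']
  simp [Exchanges, h₁, h₂, h₄, h₅]

theorem exchanges_of_pderiv_y {f : R} (hy : ∀ i, pderiv (Var.y i) f = 0)
    (hy' : ∀ i, pderiv (Var.y' i) f = 0) : Exchanges f := by
  have vanish : ∀ {f : R}, (∀ i, pderiv (Var.y i) f = 0) → (∀ i, pderiv (Var.y' i) f = 0) →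
      lamYtLin f = 0 ∧ deltaLin f = 0 ∧ mzLin f = 0 := fun hy hy' => by
    refine ⟨?_, ?_, ?_⟩
    · simp [lamYtLin, myLin, lamLin_eq_zero, exchLin_eq_zero, hy, hy']
    · simp [deltaLin, replLin_eq_zero, hy, hy']
    · simp [mzLin, exchLin_eq_zero, hy, hy']
  obtain ⟨h₁, h₂, h₃⟩ := vanish hy hy'
  have hL : lamZtLin f = lamLin injective_z f + lamLin injective_z' f := by
    simp [lamZtLin, h₃]
  obtain ⟨h₄, h₅, -⟩ := vanish (f := lamZtLin f)
    (fun i => by simp [hL, pderiv_lamLin_eq_zero, hy]) fun i => by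
      simp [hL, pderiv_lamLin_eq_zero, hy']
  simp [Exchanges, h₁, h₂, h₄, h₅]

theorem exists_rename_of_mem_Psub {f : R} (hf : f ∈ (Psub : Set R)) :
    ∃ g : MvPolynomial ℕ K, rename Var.p g = f := by
  have h : ↑f.vars ⊆ Set.range Var.p := mem_supported.1 hf
  exact exists_rename_eq_of_vars_subset_range f Var.p (fun _ _ h => Var.p.inj h) h

theorem exchanges_of_mem_PYZt {f : R} (hf : f ∈ PYZt) : Exchanges f := by
  induction hf using Submodule.span_induction with
  | zero => simp [Exchanges]
  | add f g _ _ hf hg =>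
    obtain ⟨h₁, h₂, h₃⟩ := hf
    obtain ⟨k₁, k₂, k₃⟩ := hg
    simp only [Exchanges, map_add] at *
    exact ⟨by linear_combination h₁ + k₁, by linear_combination h₂ + k₂,
      by linear_combination h₃ + k₃⟩
  | smul c f _ hf =>
    obtain ⟨h₁, h₂, h₃⟩ := hf
    simp only [Exchanges, map_smul, ← smul_add, h₁, h₂, h₃, and_self]
  | mem f hf =>
    obtain hf | ⟨h, hh, hf⟩ := hf
    · obtain ⟨g, rfl⟩ := exists_rename_of_mem_Psub hf
      exact exchanges_of_pderiv_z (fun i => pderiv_rename_p_eq_zero (by simp) g)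
        fun i => pderiv_rename_p_eq_zero (by simp) g
    · obtain ⟨g, rfl⟩ := exists_rename_of_mem_Psub hh
      obtain ⟨i, rfl⟩ | ⟨i, rfl⟩ | ⟨i, j, rfl⟩ | ⟨i, rfl⟩ | ⟨i, rfl⟩ | ⟨i, j, rfl⟩ := hf
      · exact exchanges_of_pderiv_z
          (fun j => by simp [pderiv_rename_p_eq_zero])
          fun j => by simp [pderiv_rename_p_eq_zero]
      · exact exchanges_of_pderiv_y
          (fun j => by simp [pderiv_rename_p_eq_zero])
          fun j => by simp [pderiv_rename_p_eq_zero]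
      · rw [← emb_mono]
        exact exchanges_emb _
      · exact exchanges_of_pderiv_z
          (fun j => by simp [pderiv_rename_p_eq_zero])
          fun j => by simp [pderiv_rename_p_eq_zero]
      · exact exchanges_of_pderiv_y
          (fun j => by simp [pderiv_rename_p_eq_zero])
          fun j => by simp [pderiv_rename_p_eq_zero]
      · rw [← emb_mono]
        exact exchanges_emb' _

end Transfer

end ModelAndTransfer

/-- **Fourfold exchange identity** (relation (4.7b) of Chapuy–Dołęga):
`(Λ_Z̃+Δ)Λ_Ỹ = Λ_Ỹ(Λ_Z̃+Δ) = (Λ_Ỹ+Δ)Λ_Z̃ = Λ_Z̃(Λ_Ỹ+Δ)` on `𝒫_{Ỹ,Z̃}`. -/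
theorem fourfold_exchange :
    ∀ f ∈ PYZt,
      (LamZt (LamYt f) + Delta (LamYt f) = LamYt (LamZt f + Delta f)) ∧
      (LamYt (LamZt f + Delta f) = LamYt (LamZt f) + Delta (LamZt f)) ∧
      (LamYt (LamZt f) + Delta (LamZt f) = LamZt (LamYt f + Delta f)) := by
  exact fun f hf => exchanges_of_mem_PYZt hf
end
end
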